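/- Let A ⊆ ℝP^n be an L-convex-concave set with dim L = 1 (L a projective line). Let a₁, a₂, a₃, a₄ be four distinct points of L dividing L into four pairwise disjoint open arcs ⟨a₁,a₂⟩, ⟨a₂,a₃⟩, ⟨a₃,a₄⟩, ⟨a₄,a₁⟩ whose union is L ∖ {a₁,a₂,a₃,a₄}, and set I₁ = L ∖ ⟨a₁,a₂⟩, I₂ = L ∖ ⟨a₂,a₃⟩, I₃ = L ∖ ⟨a₃,a₄⟩, I₄ = L ∖ ⟨a₄,a₁⟩ (four closed segments of L, which together cover L and have pairwise disjoint complements). Suppose that for every 2-dimensional projective subspace N with L ⊆ N, the section A ∩ N is pointed with respect to each of I₁, I₂, I₃, I₄ (as a subset of the projective plane N with hyperplane L). Then A contains a projective subspace of dimension n − 2. -/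

import Mathlib

open Module Set Pointwise

noncomputable section

namespace CC

/-- The underlying vector space of `ℝPⁿ`. -/
abbrev Vec (n : ℕ) : Type := Fin (n + 1) → ℝ

/-- Real projective `n`-space `ℝPⁿ = ℙ(ℝ^{n+1})`. -/
abbrev Pt (n : ℕ) : Type := Projectivization ℝ (Vec n)

/-- The dual projective space `(ℝPⁿ)*`, whose points are the hyperplanes of `ℝPⁿ`. -/
abbrev DPt (n : ℕ) : Type := Projectivization ℝ (Module.Dual ℝ (Vec n))

/-- The quotient topology on a projectivization. -/
instance projTop {K V : Type*} [DivisionRing K] [AddCommGroup V] [Module K V]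
    [TopologicalSpace V] : TopologicalSpace (Projectivization K V) :=
  instTopologicalSpaceQuotient

/-- The canonical topology on the dual of `ℝ^{n+1}` (transported through any linear
coordinate system; all bases induce the same topology). -/
instance dualTop (n : ℕ) : TopologicalSpace (Module.Dual ℝ (Vec n)) :=
  TopologicalSpace.induced (Module.finBasis ℝ (Module.Dual ℝ (Vec n))).equivFun inferInstance

variable {M : Type*} [AddCommGroup M] [Module ℝ M]

/-- The point `x ∈ ℙ(M)` lies on the hyperplane corresponding to the point `π` of the
dual projective space `ℙ(M*)` (i.e. `x` is in the projectivization of the kernel of any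
functional representing `π`). -/
def Incident (π : Projectivization ℝ (Module.Dual ℝ M)) (x : Projectivization ℝ M) : Prop :=
  π.rep x.rep = 0

/-- The projectively dual set `S*_p ⊆ P*`: the set of all hyperplanes of `P`
disjoint from `S`. -/
def dualSet (A : Set (Projectivization ℝ M)) : Set (Projectivization ℝ (Module.Dual ℝ M)) :=
  {π | ∀ x ∈ A, ¬Incident π x}

/-- Projective separability: every point of the complement of `S` lies on a hyperplane
disjoint from `S`. -/
def ProjSeparable (A : Set (Projectivization ℝ M)) : Prop :=
  ∀ x ∉ A, ∃ π : Projectivization ℝ (Module.Dual ℝ M), Incident π x ∧ ∀ y ∈ A, ¬Incident π y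

/-- The projective subspace of `ℙ(M)` associated to a linear subspace `W ≤ M`. -/
def projSet (W : Submodule ℝ M) : Set (Projectivization ℝ M) :=
  {x | x.rep ∈ W}

/-- The canonical identification `ℙ(M) → ℙ(M**)` induced by the canonical isomorphism
`M ≃ M**`. -/
def toDoubleDual [FiniteDimensional ℝ M] :
    Projectivization ℝ M → Projectivization ℝ (Module.Dual ℝ (Module.Dual ℝ M)) :=
  Projectivization.map (Module.evalEquiv ℝ M).toLinearMap (Module.evalEquiv ℝ M).injective

/-- The `L`-dual set `A^⊥_L ⊆ ℙ(M*)` of a set `A ⊆ ℙ(M)` (for `L = ℙ(W)`): the set of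
all hyperplanes `π` of `ℙ(M)` meeting every section `A ∩ N` by a projective subspace
`N ⊇ L` with `dim N = dim L + 1`. -/
def LdualSet (W : Submodule ℝ M) (A : Set (Projectivization ℝ M)) :
    Set (Projectivization ℝ (Module.Dual ℝ M)) :=
  {π | ∀ N : Submodule ℝ M, W ≤ N → finrank ℝ N = finrank ℝ W + 1 →
    ∃ x ∈ A, Incident π x ∧ x.rep ∈ N}

/-- `(A^⊥_L)^⊥_{L*}`, brought back from `ℙ(M**)` to `ℙ(M)` via the canonical
identification `M ≅ M**`. -/
def Lbidual [FiniteDimensional ℝ M] (W : Submodule ℝ M) (A : Set (Projectivization ℝ M)) :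
    Set (Projectivization ℝ M) :=
  toDoubleDual ⁻¹' LdualSet W.dualAnnihilator (LdualSet W A)

/-- The image of a set `A ⊆ ℙ(M)` under the projection from the center `ℙ(W)`:
`y` is in the image iff some point `x ∈ A` not in the center projects to `y`
(i.e. the class of a representing vector of `x` spans the line `y`). -/
def projImage (W : Submodule ℝ M) (A : Set (Projectivization ℝ M)) :
    Set (Projectivization ℝ (M ⧸ W)) :=
  {y | ∃ x ∈ A, x.rep ∉ W ∧ W.mkQ x.rep ∈ y.submodule}

/-- The coordinate, in the affine chart of `ℙ(M)` given by a functional `φ`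
(the complement of the hyperplane `ℙ(ker φ)`, identified with `{v | φ v = 1}`),
of a point `x` with `φ x.rep ≠ 0`. -/
def projChart (φ : Module.Dual ℝ M) (x : Projectivization ℝ M) : M :=
  (φ x.rep)⁻¹ • x.rep

/-- A convex subset of a projective space: a set disjoint from some hyperplane and
convex in the corresponding affine chart. -/
def IsProjConvex (A : Set (Projectivization ℝ M)) : Prop :=
  ∃ φ : Module.Dual ℝ M, φ ≠ 0 ∧ (∀ x ∈ A, φ x.rep ≠ 0) ∧ Convex ℝ (projChart φ '' A)

/-- `L`-convex-concavity of a closed set `A ⊆ ℙ(M)` with respect to the projective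
subspace `L = ℙ(W)`: `A` is closed, disjoint from `L`, all sections of `A` by
projective subspaces `N ⊇ L` with `dim N = dim L + 1` are nonempty and convex, and the
complement of the projection of `A` from any center `T ⊂ L` with `dim T = dim L − 1`
is open and convex. -/
def IsLConvexConcave [TopologicalSpace M] (W : Submodule ℝ M)
    (A : Set (Projectivization ℝ M)) : Prop :=
  IsClosed A ∧ (∀ x ∈ A, x.rep ∉ W) ∧
    (∀ N : Submodule ℝ M, W ≤ N → finrank ℝ N = finrank ℝ W + 1 →
      (A ∩ projSet N).Nonempty ∧ IsProjConvex (A ∩ projSet N)) ∧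
    (∀ T : Submodule ℝ M, T ≤ W → finrank ℝ T + 1 = finrank ℝ W →
      IsOpen (projImage T A)ᶜ ∧ IsProjConvex (projImage T A)ᶜ)

/-- The lift of a hyperplane `π` of `ℙ(M)` containing the center `ℙ(Q)` to a hyperplane
of the quotient projective space `ℙ(M ⧸ Q)`. -/
def liftHyperplane (Q : Submodule ℝ M) (π : Projectivization ℝ (Module.Dual ℝ M))
    (h : ∀ v ∈ Q, π.rep v = 0) : Projectivization ℝ (Module.Dual ℝ (M ⧸ Q)) :=
  Projectivization.mk ℝ (Q.liftQ π.rep fun v hv => LinearMap.mem_ker.mpr (h v hv))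
    (fun hz => π.rep_nonzero (by
      have h2 := Submodule.liftQ_mkQ Q π.rep (fun v hv => LinearMap.mem_ker.mpr (h v hv))
      rw [hz] at h2
      simpa using h2.symm))

/-- Affine separability of a set `B`, inside the affine chart of `ℙ(M)` given by a
functional `φ`: every point of the chart outside `B` lies in a closed half-space of the
chart (cut out by an affine function which is nonconstant on the chart) disjoint
from `B`.  A closed half-space of the chart `{v | φ v = 1}` is cut out by a functional
`g` (nonproportional to `φ`, so that `g` is nonconstant on the chart) via the
scale-invariant condition `g(x)/φ(x) ≥ 0`. -/
def AffSepInChart (φ : Module.Dual ℝ M) (B : Set (Projectivization ℝ M)) : Prop :=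
  ∀ y : Projectivization ℝ M, φ y.rep ≠ 0 → y ∉ B →
    ∃ g : Module.Dual ℝ M, (∀ c : ℝ, g ≠ c • φ) ∧ 0 ≤ g y.rep / φ y.rep ∧
      ∀ z ∈ B, g z.rep / φ z.rep < 0

/-- `A` is coseparable relative to `L = ℙ(W)`: `A` is disjoint from `L`, and for every
hyperplane `L₁` of `L`, the complement of the projection of `A` from the center `L₁`
misses some hyperplane of `ℝPⁿ/L₁` and is affinely separable in the corresponding
affine chart. -/
def Coseparable (W : Submodule ℝ M) (A : Set (Projectivization ℝ M)) : Prop :=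
  (∀ x ∈ A, x.rep ∉ W) ∧
    ∀ W₁ : Submodule ℝ M, W₁ ≤ W → finrank ℝ W₁ + 1 = finrank ℝ W →
      ∃ φ : Module.Dual ℝ (M ⧸ W₁), φ ≠ 0 ∧
        (∀ y ∈ (projImage W₁ A)ᶜ, φ y.rep ≠ 0) ∧
        AffSepInChart φ (projImage W₁ A)ᶜ

/-- A set `S` contained in the projective subspace `N = ℙ(Nsub)`, disjoint from the
hyperplane `L = ℙ(W)` of `N`, is pointed with respect to `Δ ⊆ L` if it has two vertices
`a, b ∈ S` such that a hyperplane `p` of `N` disjoint from `Δ` meets `S` iff it meets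
the straight segment joining `a` and `b` in the affine chart `N ∖ L` (the chart being
given by any functional vanishing on `W` and nonzero at `a` and `b`). -/
def PointedWrt (W Nsub : Submodule ℝ M) (Δ S : Set (Projectivization ℝ M)) : Prop :=
  ∃ a ∈ S, ∃ b ∈ S,
    ∀ P : Submodule ℝ M, P ≤ Nsub → finrank ℝ P + 1 = finrank ℝ Nsub →
      (∀ x ∈ Δ, x.rep ∉ P) →
      ((∃ x ∈ S, x.rep ∈ P) ↔
        ∀ φ : Module.Dual ℝ M, (∀ w ∈ W, φ w = 0) → φ a.rep ≠ 0 → φ b.rep ≠ 0 →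
          ∃ t ∈ Icc (0 : ℝ) 1,
            t • ((φ a.rep)⁻¹ • a.rep) + (1 - t) • ((φ b.rep)⁻¹ • b.rep) ∈ P)

/-- The hyperplane `Γ_c` of `ℙ(M)` containing the center `ℙ(W)` and corresponding to the
point `c` of `ℙ(M ⧸ W)`. -/
def gammaSet (W : Submodule ℝ M) (c : Projectivization ℝ (M ⧸ W)) :
    Set (Projectivization ℝ M) :=
  {x | W.mkQ x.rep ∈ c.submodule}

/-- The surgery `S_{[a,b]}(A)` of a set `A ⊆ ℙ(M)` along the arc `Arc = [a,b]` of the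
projective line `ℙ(M ⧸ W)`, computed in the affine chart given by a functional `φ`
whose kernel is the cone of the hyperplane `Γ_c` (for a point `c ∉ Arc`): points
projecting into `Arc` are replaced by the convex hull of `(A ∩ Γ_a) ∪ (A ∩ Γ_b)` taken
in the chart, points projecting outside `Arc` are kept iff they belong to `A`, and the
result is disjoint from `ℙ(W)`. -/
def surgery (W : Submodule ℝ M) (a b : Projectivization ℝ (M ⧸ W))
    (Arc : Set (Projectivization ℝ (M ⧸ W))) (φ : Module.Dual ℝ M)
    (A : Set (Projectivization ℝ M)) : Set (Projectivization ℝ M) :=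
  {x | x.rep ∉ W ∧
    ((∃ y ∈ Arc, W.mkQ x.rep ∈ y.submodule) →
      φ x.rep ≠ 0 ∧
        projChart φ x ∈ convexHull ℝ (projChart φ '' (A ∩ (gammaSet W a ∪ gammaSet W b)))) ∧
    ((¬∃ y ∈ Arc, W.mkQ x.rep ∈ y.submodule) → x ∈ A)}

/-- The linear map `M* ⧸ T → Q*` (for `Q = ℙ(T)*`-perp, i.e. `Q = T.dualCoannihilator`)
realizing the canonical identification of `(ℝPⁿ)*/T` with the space of hyperplanes of
the projective space `ℙ(Q)`: the class of a hyperplane `π ⊅ Q` of `ℝPⁿ` corresponds to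
the hyperplane `π ∩ ℙ(Q)` of `ℙ(Q)`. -/
def restrictToSub (T : Submodule ℝ (Module.Dual ℝ M)) :
    (Module.Dual ℝ M ⧸ T) →ₗ[ℝ] Module.Dual ℝ T.dualCoannihilator :=
  T.liftQ (T.dualCoannihilator.subtype.dualMap)
    (fun φ hφ => LinearMap.mem_ker.mpr
      (LinearMap.ext fun q => (Submodule.mem_dualCoannihilator _).mp q.2 φ hφ))



/-- planar determinant -/
def dt (w x : ℝ × ℝ) : ℝ := w.1 * x.2 - w.2 * x.1

lemma dt_add_right (w x y : ℝ × ℝ) : dt w (x + y) = dt w x + dt w y := by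
  simp [dt]; ring
lemma dt_smul_right (w x : ℝ × ℝ) (c : ℝ) : dt w (c • x) = c * dt w x := by
  simp [dt]; ring
lemma dt_sub_right (w x y : ℝ × ℝ) : dt w (x - y) = dt w x - dt w y := by
  simp [dt]; ring
lemma dt_neg_right (w x : ℝ × ℝ) : dt w (-x) = - dt w x := by
  simp [dt]; ring
lemma dt_add_left (w x y : ℝ × ℝ) : dt (x + y) w = dt x w + dt y w := by
  simp [dt]; ring
lemma dt_smul_left (w x : ℝ × ℝ) (c : ℝ) : dt (c • x) w = c * dt x w := by
  simp [dt]; ring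
lemma dt_neg_left (w x : ℝ × ℝ) : dt (-x) w = - dt x w := by
  simp [dt]; ring
lemma dt_cont (w : ℝ × ℝ) : Continuous (dt w) := by
  unfold dt; fun_prop

/-- abstract family of sections -/
structure Sys {U : Type*} [AddCommGroup U] [Module ℝ U] (A : U → Set (ℝ × ℝ)) : Prop where
  cpt : ∀ u, IsCompact (A u)
  conv : ∀ u, Convex ℝ (A u)
  ne : ∀ u, (A u).Nonempty
  smul : ∀ (c : ℝ) u x, x ∈ A u → c • x ∈ A (c • u)
  add : ∀ u v, ∀ z ∈ A (u + v), ∃ x ∈ A u, ∃ y ∈ A v, z = x + y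

/-- support function -/
def hs {U : Type*} (A : U → Set (ℝ × ℝ)) (u : U) (w : ℝ × ℝ) : ℝ := sSup (dt w '' A u)

section
variable {U : Type*} [AddCommGroup U] [Module ℝ U] {A : U → Set (ℝ × ℝ)}

lemma Sys.le_h (S : Sys A) {u : U} {x : ℝ × ℝ} (hx : x ∈ A u) (w : ℝ × ℝ) :
    dt w x ≤ hs A u w :=
  le_csSup ((S.cpt u).image (dt_cont w)).bddAbove (mem_image_of_mem _ hx)

lemma Sys.ex_h (S : Sys A) (u : U) (w : ℝ × ℝ) : ∃ x ∈ A u, dt w x = hs A u w := by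
  have := ((S.cpt u).image (dt_cont w)).sSup_mem ((S.ne u).image _)
  exact this

lemma Sys.h_le (S : Sys A) {u : U} {w : ℝ × ℝ} {c : ℝ} (h : ∀ x ∈ A u, dt w x ≤ c) :
    hs A u w ≤ c := by
  obtain ⟨x, hx, he⟩ := S.ex_h u w
  rw [← he]; exact h x hx

lemma Sys.h_add_left (S : Sys A) (u v : U) (w : ℝ × ℝ) :
    hs A (u + v) w ≤ hs A u w + hs A v w := by
  apply S.h_le
  intro z hz
  obtain ⟨x, hx, y, hy, rfl⟩ := S.add u v z hz
  rw [dt_add_right]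
  exact add_le_add (S.le_h hx w) (S.le_h hy w)

lemma Sys.h_add_right (S : Sys A) (u : U) (w w' : ℝ × ℝ) :
    hs A u (w + w') ≤ hs A u w + hs A u w' := by
  apply S.h_le
  intro z hz
  rw [dt_add_left]
  exact add_le_add (S.le_h hz w) (S.le_h hz w')

lemma Sys.mem_smul (S : Sys A) {c : ℝ} (hc : c ≠ 0) {u : U} {x : ℝ × ℝ} (hx : x ∈ A (c • u)) :
    ∃ y ∈ A u, x = c • y := by
  refine ⟨c⁻¹ • x, ?_, by rw [smul_smul, mul_inv_cancel₀ hc, one_smul]⟩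
  have := S.smul c⁻¹ _ _ hx
  rwa [smul_smul, inv_mul_cancel₀ hc, one_smul] at this

lemma Sys.h_smul_left (S : Sys A) {c : ℝ} (hc : 0 < c) (u : U) (w : ℝ × ℝ) :
    hs A (c • u) w = c * hs A u w := by
  apply le_antisymm
  · apply S.h_le
    intro x hx
    obtain ⟨y, hy, rfl⟩ := S.mem_smul hc.ne' hx
    rw [dt_smul_right]
    exact mul_le_mul_of_nonneg_left (S.le_h hy w) hc.le
  · obtain ⟨x, hx, he⟩ := S.ex_h u w
    rw [← he, ← dt_smul_right]
    exact S.le_h (S.smul c _ _ hx) w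

lemma Sys.h_neg_left (S : Sys A) (u : U) (w : ℝ × ℝ) :
    hs A (-u) w = hs A u (-w) := by
  apply le_antisymm
  · apply S.h_le
    intro x hx
    rw [← neg_one_smul ℝ] at hx
    obtain ⟨y, hy, rfl⟩ := S.mem_smul (by norm_num) hx
    have := S.le_h hy (-w)
    rw [dt_neg_left] at this
    rw [dt_smul_right]; linarith
  · obtain ⟨x, hx, he⟩ := S.ex_h u (-w)
    have h2 := S.le_h (S.smul (-1) _ _ hx) w
    rw [neg_one_smul, neg_one_smul, dt_neg_right] at h2
    rw [← he]
    rw [dt_neg_left]; linarith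

lemma Sys.h_smul_right (S : Sys A) {c : ℝ} (hc : 0 ≤ c) (u : U) (w : ℝ × ℝ) :
    hs A u (c • w) = c * hs A u w := by
  apply le_antisymm
  · apply S.h_le
    intro x hx
    rw [dt_smul_left]
    exact mul_le_mul_of_nonneg_left (S.le_h hx w) hc
  · obtain ⟨x, hx, he⟩ := S.ex_h u w
    rw [← he, ← dt_smul_left]
    exact S.le_h hx _

lemma Sys.mem_of (S : Sys A) {u : U} {z : ℝ × ℝ} (h : ∀ w, dt w z ≤ hs A u w) : z ∈ A u := by
  by_contra hz
  obtain ⟨f, c, hf, hc⟩ := geometric_hahn_banach_closed_point (S.conv u) (S.cpt u).isClosed hz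
  have key : ∀ x, f x = dt (f (0, 1), - f (1, 0)) x := by
    intro x
    have : x = x.1 • ((1 : ℝ), (0 : ℝ)) + x.2 • ((0 : ℝ), (1 : ℝ)) := by
      ext <;> simp
    conv_lhs => rw [this]
    rw [map_add, map_smul, map_smul]
    simp [dt]; ring
  have h1 := h (f (0, 1), - f (1, 0))
  obtain ⟨x, hx, he⟩ := S.ex_h u (f (0, 1), - f (1, 0))
  rw [← he, ← key, ← key] at h1
  linarith [hf x hx]

/-- Any four sections are met by a common plane section. -/
lemma Sys.four (S : Sys A) {p2 q2 p3 q3 : ℝ} (hp2 : p2 ≠ 0) (hq2 : q2 ≠ 0) (hp3 : p3 ≠ 0)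
    (hq3 : q3 ≠ 0) (u2 u3 : U) :
    ∃ x ∈ A u2, ∃ y ∈ A u3, -(p2 • x) - p3 • y ∈ A (-(p2 • u2) - p3 • u3) ∧
      -(q2 • x) - q3 • y ∈ A (-(q2 • u2) - q3 • u3) := by
  set X := A u2 ×ˢ A u3 with hX
  have hXc : IsCompact X := (S.cpt u2).prod (S.cpt u3)
  have hXv : Convex ℝ X := (S.conv u2).prod (S.conv u3)
  let T (p r : ℝ) : ((ℝ × ℝ) × (ℝ × ℝ)) →L[ℝ] (ℝ × ℝ) :=
    -(p • ContinuousLinearMap.fst ℝ (ℝ × ℝ) (ℝ × ℝ)) - r • ContinuousLinearMap.snd ℝ (ℝ × ℝ) (ℝ × ℝ)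
  let Z (p r : ℝ) := X ∩ (T p r) ⁻¹' A (-(p • u2) - r • u3)
  have hZc : ∀ p r, IsCompact (Z p r) := fun p r =>
    hXc.inter_right ((S.cpt _).isClosed.preimage (T p r).continuous)
  have hZv : ∀ p r, Convex ℝ (Z p r) := fun p r =>
    hXv.inter ((S.conv _).linear_preimage (T p r).toLinearMap)
  have pr1 : ∀ p r, p ≠ 0 → r ≠ 0 → ∀ x ∈ A u2, ∃ y, (x, y) ∈ Z p r := by
    intro p r hp hr x hx
    have h1 : p • u2 = -(-(p • u2) - r • u3) + (-r) • u3 := by module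
    have h2 := S.smul p _ _ hx
    rw [h1] at h2
    obtain ⟨a, ha, b, hb, hab⟩ := S.add _ _ _ h2
    obtain ⟨y, hy, rfl⟩ := S.mem_smul (neg_ne_zero.mpr hr) hb
    refine ⟨y, ⟨hx, hy⟩, ?_⟩
    have h3 := S.smul (-1) _ _ ha
    rw [neg_one_smul, neg_one_smul, neg_neg] at h3
    have : T p r (x, y) = -a := by
      simp only [T]
      simp [hab]
    simpa [this] using h3
  have pr2 : ∀ p r, p ≠ 0 → r ≠ 0 → ∀ y ∈ A u3, ∃ x, (x, y) ∈ Z p r := by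
    intro p r hp hr y hy
    have h1 : r • u3 = -(-(p • u2) - r • u3) + (-p) • u2 := by module
    have h2 := S.smul r _ _ hy
    rw [h1] at h2
    obtain ⟨a, ha, b, hb, hab⟩ := S.add _ _ _ h2
    obtain ⟨x, hx, rfl⟩ := S.mem_smul (neg_ne_zero.mpr hp) hb
    refine ⟨x, ⟨hx, hy⟩, ?_⟩
    have h3 := S.smul (-1) _ _ ha
    rw [neg_one_smul, neg_one_smul, neg_neg] at h3
    have : T p r (x, y) = -a := by
      simp only [T]
      simp [hab]
    simpa [this] using h3
  by_contra hcon
  have hdis : Disjoint (Z p2 p3) (Z q2 q3) := by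
    rw [Set.disjoint_left]
    rintro ⟨x, y⟩ ⟨hx, h1⟩ ⟨_, h2⟩
    apply hcon
    refine ⟨x, hx.1, y, hx.2, ?_, ?_⟩
    · simpa [T] using h1
    · simpa [T] using h2
  obtain ⟨f, c, c', hf, hcc, hg⟩ := geometric_hahn_banach_compact_closed (hZv p2 p3) (hZc p2 p3)
    (hZv q2 q3) (hZc q2 q3).isClosed hdis
  have hsplit : ∀ x y, f (x, y) = f (x, 0) + f (0, y) := by
    intro x y; rw [← map_add]; simp
  obtain ⟨xs, hxs, hxm⟩ := (S.cpt u2).exists_isMaxOn (S.ne u2)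
    (f := fun x => f (x, 0)) (by fun_prop)
  obtain ⟨ys, hys, hym⟩ := (S.cpt u3).exists_isMinOn (S.ne u3)
    (f := fun y => f (0, y)) (by fun_prop)
  obtain ⟨y, hy⟩ := pr1 p2 p3 hp2 hp3 xs hxs
  obtain ⟨x, hx⟩ := pr2 q2 q3 hq2 hq3 ys hys
  have e1 := hf _ hy
  have e2 := hg _ hx
  rw [hsplit] at e1 e2
  have e3 : f (x, 0) ≤ f (xs, 0) := hxm hx.1.1
  have e4 : f (0, ys) ≤ f (0, y) := hym hy.1.2
  linarith

end

section
variable {U : Type*} [AddCommGroup U] [Module ℝ U] {A : U → Set (ℝ × ℝ)}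

/-- Hahn-Banach step for four directions. -/
lemma Sys.select4 (S : Sys A) {p2 q2 p3 q3 : ℝ} (hp2 : p2 ≠ 0) (hq2 : q2 ≠ 0) (hp3 : p3 ≠ 0)
    (hq3 : q3 ≠ 0) :
    ∃ s : U →ₗ[ℝ] (ℝ × ℝ), ∀ u, dt (1, 0) (s u) ≤ hs A u (1, 0) ∧
      dt (0, 1) (s u) ≤ hs A u (0, 1) ∧ dt (p2, q2) (s u) ≤ hs A u (p2, q2) ∧
      dt (p3, q3) (s u) ≤ hs A u (p3, q3) := by
  let N : (U × U) × (U × U) → ℝ := fun z =>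
    hs A z.1.1 (1, 0) + hs A z.1.2 (0, 1) + hs A z.2.1 (p2, q2) + hs A z.2.2 (p3, q3)
  let emb : (U × U) →ₗ[ℝ] (U × U) × (U × U) :=
    (LinearMap.prod (-(p2 • LinearMap.fst ℝ U U) - p3 • LinearMap.snd ℝ U U)
      (-(q2 • LinearMap.fst ℝ U U) - q3 • LinearMap.snd ℝ U U)).prod LinearMap.id
  let f : ((U × U) × (U × U)) →ₗ.[ℝ] ℝ := ⟨LinearMap.range emb, 0⟩
  obtain ⟨g, hg0, hgN⟩ := exists_extension_of_le_sublinear f N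
    (by
      intro c hc z
      simp only [N, Prod.smul_fst, Prod.smul_snd, S.h_smul_left hc]
      ring)
    (by
      intro z z'
      simp only [N, Prod.fst_add, Prod.snd_add]
      have := S.h_add_left z.1.1 z'.1.1 (1, 0)
      have := S.h_add_left z.1.2 z'.1.2 (0, 1)
      have := S.h_add_left z.2.1 z'.2.1 (p2, q2)
      have := S.h_add_left z.2.2 z'.2.2 (p3, q3)
      linarith)
    (by
      rintro ⟨z, ⟨u2, u3⟩, rfl⟩
      obtain ⟨x, hx, y, hy, h0, h1⟩ := S.four hp2 hq2 hp3 hq3 u2 u3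
      have e0 := S.le_h h0 (1, 0)
      have e1 := S.le_h h1 (0, 1)
      have e2 := S.le_h hx (p2, q2)
      have e3 := S.le_h hy (p3, q3)
      have : (0 : ℝ) ≤ N (emb (u2, u3)) := by
        simp only [N, emb]
        simp only [LinearMap.prod_apply, Function.prod, LinearMap.sub_apply, LinearMap.neg_apply,
          LinearMap.smul_apply, LinearMap.fst_apply, LinearMap.snd_apply, LinearMap.id_apply]
        simp only [dt, Prod.fst_sub, Prod.snd_sub, Prod.fst_neg, Prod.snd_neg, Prod.smul_fst,
          Prod.smul_snd, smul_eq_mul] at e0 e1 e2 e3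
        nlinarith
      simpa [f] using this)
  have hN0 : ∀ w, hs A (0 : U) w = 0 := by
    intro w
    have h1 := S.h_smul_left (c := 2) (by norm_num) (0 : U) w
    rw [smul_zero] at h1; linarith
  have hR : ∀ u2 u3, g (emb (u2, u3)) = 0 := by
    intro u2 u3
    have := hg0 ⟨emb (u2, u3), ⟨(u2, u3), rfl⟩⟩
    simpa [f] using this
  let g0 : U →ₗ[ℝ] ℝ := g ∘ₗ LinearMap.inl ℝ (U × U) (U × U) ∘ₗ LinearMap.inl ℝ U U
  let g1 : U →ₗ[ℝ] ℝ := g ∘ₗ LinearMap.inl ℝ (U × U) (U × U) ∘ₗ LinearMap.inr ℝ U U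
  have hsp : ∀ a b c d, g ((a, b), (c, d)) = g0 a + g1 b + g ((0, 0), (c, 0)) + g ((0, 0), (0, d)) := by
    intro a b c d
    simp only [g0, g1, LinearMap.comp_apply, LinearMap.inl_apply, LinearMap.inr_apply, ← map_add]
    congr 1
    simp
  refine ⟨(-g1).prod g0, fun u => ?_⟩
  have r2 : g ((0, 0), (u, 0)) = p2 * g0 u + q2 * g1 u := by
    have := hR u 0
    simp only [emb, LinearMap.prod_apply, Function.prod, LinearMap.sub_apply, LinearMap.neg_apply,
          LinearMap.smul_apply, LinearMap.fst_apply, LinearMap.snd_apply, LinearMap.id_apply] at this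
    rw [hsp] at this
    have z0 : g ((0, 0), ((0 : U), (0 : U))) = 0 := map_zero g
    simp only [smul_zero, sub_zero, map_neg, map_smul, smul_eq_mul, z0] at this
    linarith
  have r3 : g ((0, 0), (0, u)) = p3 * g0 u + q3 * g1 u := by
    have := hR 0 u
    simp only [emb, LinearMap.prod_apply, Function.prod, LinearMap.sub_apply, LinearMap.neg_apply,
          LinearMap.smul_apply, LinearMap.fst_apply, LinearMap.snd_apply, LinearMap.id_apply] at this
    rw [hsp] at this
    have z0 : g ((0, 0), ((0 : U), (0 : U))) = 0 := map_zero g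
    simp only [smul_zero, neg_zero, zero_sub, map_neg, map_smul, smul_eq_mul, z0] at this
    linarith
  have n0 := hgN ((u, 0), (0, 0))
  have n1 := hgN ((0, u), (0, 0))
  have n2 := hgN ((0, 0), (u, 0))
  have n3 := hgN ((0, 0), (0, u))
  rw [r2] at n2
  rw [r3] at n3
  rw [hsp] at n0 n1
  have z0 : g ((0, 0), ((0 : U), (0 : U))) = 0 := map_zero g
  simp only [N, hN0, z0, map_zero] at n0 n1 n2 n3
  simp only [dt, LinearMap.prod_apply, Function.prod, LinearMap.neg_apply]
  refine ⟨?_, ?_, ?_, ?_⟩ <;> linarith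

/-- pointedness for the open cone spanned by two vectors -/
def PtAt (A : U → Set (ℝ × ℝ)) (b b' : ℝ × ℝ) (u : U) : Prop :=
  ∃ p ∈ A u, ∃ q ∈ A u, ∀ x ∈ A u, ∀ α : ℝ, α > 0 → ∀ β : ℝ, β > 0 →
    min (dt (α • b + β • b') p) (dt (α • b + β • b') q) ≤ dt (α • b + β • b') x ∧
    dt (α • b + β • b') x ≤ max (dt (α • b + β • b') p) (dt (α • b + β • b') q)

/-- additivity of the support function on the cone spanned by two vectors -/
def Good (A : U → Set (ℝ × ℝ)) (b b' : ℝ × ℝ) (u : U) : Prop :=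
  ∀ α β : ℝ, 0 ≤ α → 0 ≤ β → α * hs A u b + β * hs A u b' ≤ hs A u (α • b + β • b')

lemma PtAt.closed {b b' : ℝ × ℝ} {u : U} (h : PtAt A b b' u) :
    ∃ p ∈ A u, ∃ q ∈ A u, ∀ x ∈ A u, ∀ α : ℝ, α ≥ 0 → ∀ β : ℝ, β ≥ 0 →
    min (dt (α • b + β • b') p) (dt (α • b + β • b') q) ≤ dt (α • b + β • b') x ∧
    dt (α • b + β • b') x ≤ max (dt (α • b + β • b') p) (dt (α • b + β • b') q) := by
  obtain ⟨p, hp, q, hq, h⟩ := h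
  refine ⟨p, hp, q, hq, fun x hx α hα β hβ => ?_⟩
  have hc : ∀ y : ℝ × ℝ, Continuous (fun ε : ℝ => dt ((α + ε) • b + (β + ε) • b') y) := by
    intro y; unfold dt; simp only [Prod.fst_add, Prod.snd_add, Prod.smul_fst, Prod.smul_snd]
    fun_prop
  have ht : ∀ y : ℝ × ℝ, Filter.Tendsto (fun ε : ℝ => dt ((α + ε) • b + (β + ε) • b') y)
      (nhdsWithin 0 (Ioi 0)) (nhds (dt (α • b + β • b') y)) := by
    intro y
    have := ((hc y).tendsto 0).mono_left (nhdsWithin_le_nhds (s := Ioi 0))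
    simpa using this
  constructor
  · refine le_of_tendsto_of_tendsto ((ht p).min (ht q)) (ht x) ?_
    filter_upwards [self_mem_nhdsWithin] with ε hε
    have : (0 : ℝ) < ε := hε
    exact (h x hx _ (by linarith : α + ε > 0) _ (by linarith : β + ε > 0)).1
  · refine le_of_tendsto_of_tendsto (ht x) ((ht p).max (ht q)) ?_
    filter_upwards [self_mem_nhdsWithin] with ε hε
    have : (0 : ℝ) < ε := hε
    exact (h x hx _ (by linarith : α + ε > 0) _ (by linarith : β + ε > 0)).2

/-- a pointed section with non-additive support function is a segment -/
lemma Sys.seg (S : Sys A) {b b' : ℝ × ℝ} (hD : dt b b' ≠ 0) {u : U} (h : PtAt A b b' u)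
    (hb : ¬ Good A b b' u) : ∃ p ∈ A u, ∃ q ∈ A u, p ≠ q ∧ ∀ x ∈ A u, ∃ t : ℝ, 0 ≤ t ∧ t ≤ 1 ∧
      x = p + t • (q - p) := by
  obtain ⟨p, hp, q, hq, h⟩ := h.closed
  -- if one of the two points dominates, the support function is additive
  have dom : ∀ r ∈ A u, (∀ x ∈ A u, ∀ α : ℝ, α ≥ 0 → ∀ β : ℝ, β ≥ 0 →
      dt (α • b + β • b') x ≤ dt (α • b + β • b') r) → Good A b b' u := by
    intro r hr hx α β hα hβ
    have e0 := S.le_h hr (α • b + β • b')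
    have e1 : hs A u b ≤ dt b r := S.h_le fun x hxx => by
      simpa using hx x hxx 1 (by norm_num) 0 le_rfl
    have e2 : hs A u b' ≤ dt b' r := S.h_le fun x hxx => by
      simpa using hx x hxx 0 le_rfl 1 (by norm_num)
    rw [dt_add_left, dt_smul_left, dt_smul_left] at e0
    have := mul_le_mul_of_nonneg_left e1 hα
    have := mul_le_mul_of_nonneg_left e2 hβ
    linarith
  -- swap symmetric situation
  have main : ∀ p ∈ A u, ∀ q ∈ A u, (∀ x ∈ A u, ∀ α : ℝ, α ≥ 0 → ∀ β : ℝ, β ≥ 0 →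
    min (dt (α • b + β • b') p) (dt (α • b + β • b') q) ≤ dt (α • b + β • b') x ∧
    dt (α • b + β • b') x ≤ max (dt (α • b + β • b') p) (dt (α • b + β • b') q)) →
    0 < dt b (q - p) → dt b' (q - p) < 0 → ∃ p ∈ A u, ∃ q ∈ A u, p ≠ q ∧ ∀ x ∈ A u,
      ∃ t : ℝ, 0 ≤ t ∧ t ≤ 1 ∧ x = p + t • (q - p) := by
    intro p hp q hq h hX hY
    set X := dt b (q - p) with hXd
    set Y := dt b' (q - p) with hYd
    refine ⟨p, hp, q, hq, ?_, fun x hx => ?_⟩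
    · rintro rfl
      rw [dt_sub_right] at hXd; linarith
    · have h1 := h x hx 1 (by norm_num) 0 le_rfl
      have h2 := h x hx (-Y) (by linarith) X hX.le
      simp only [one_smul, zero_smul, add_zero] at h1
      have hXq : dt b q = dt b p + X := by rw [hXd, dt_sub_right]; ring
      have hYq : dt b' q = dt b' p + Y := by rw [hYd, dt_sub_right]; ring
      rw [hXq, min_eq_left (by linarith), max_eq_right (by linarith)] at h1
      simp only [dt_add_left, dt_smul_left, hXq, hYq] at h2
      have e : -Y * (dt b p + X) + X * (dt b' p + Y) = -Y * dt b p + X * dt b' p := by ring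
      rw [e, min_self, max_self] at h2
      have h3 := le_antisymm h2.2 h2.1
      refine ⟨(dt b x - dt b p) / X, div_nonneg (by linarith) hX.le,
        (div_le_one hX).2 (by linarith), ?_⟩
      set t := (dt b x - dt b p) / X with ht
      have htX : t * X = dt b x - dt b p := by rw [ht]; field_simp
      have f1 : dt b (x - (p + t • (q - p))) = 0 := by
        rw [dt_sub_right, dt_add_right, dt_smul_right, ← hXd]; linarith
      have f2 : X * dt b' (x - (p + t • (q - p))) = 0 := by
        rw [dt_sub_right, dt_add_right, dt_smul_right, ← hYd]
        linear_combination h3 - Y * htX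
      have f2' : dt b' (x - (p + t • (q - p))) = 0 := by
        rcases mul_eq_zero.1 f2 with h | h
        · exact absurd h hX.ne'
        · exact h
      rw [← sub_eq_zero]
      generalize x - (p + t • (q - p)) = r at f1 f2'
      simp only [dt] at f1 f2' hD
      have g1 : (b.1 * b'.2 - b.2 * b'.1) * r.1 = 0 := by linear_combination b'.1 * f1 - b.1 * f2'
      have g2 : (b.1 * b'.2 - b.2 * b'.1) * r.2 = 0 := by linear_combination b'.2 * f1 - b.2 * f2'
      ext
      · simpa [hD] using g1
      · simpa [hD] using g2
  have hq1 : ∀ w, dt w (q - p) = dt w q - dt w p := fun w => dt_sub_right _ _ _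
  have hq2 : ∀ w, dt w (p - q) = dt w p - dt w q := fun w => dt_sub_right _ _ _
  rcases le_or_gt (dt b (q - p)) 0 with hX | hX
  · rcases le_or_gt (dt b' (q - p)) 0 with hY | hY
    · exfalso; apply hb
      refine dom p hp fun x hx α hα β hβ => (h x hx α hα β hβ).2.trans (max_le le_rfl ?_)
      simp only [dt_add_left, dt_smul_left]
      rw [hq1] at hX hY
      have := mul_le_mul_of_nonneg_left hX hα
      have := mul_le_mul_of_nonneg_left hY hβ
      linarith
    · rcases hX.eq_or_lt with hX0 | hX
      · exfalso; apply hb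
        refine dom q hq fun x hx α hα β hβ => (h x hx α hα β hβ).2.trans (max_le ?_ le_rfl)
        simp only [dt_add_left, dt_smul_left]
        rw [hq1] at hX0 hY
        have := mul_le_mul_of_nonneg_left hX0.ge hα
        have := mul_le_mul_of_nonneg_left hY.le hβ
        linarith
      · refine main q hq p hp (fun x hx α hα β hβ => ?_) ?_ ?_
        · rw [min_comm, max_comm]; exact h x hx α hα β hβ
        · rw [hq2]; rw [hq1] at hX; linarith
        · rw [hq2]; rw [hq1] at hY; linarith
  · rcases lt_or_ge (dt b' (q - p)) 0 with hY | hY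
    · exact main p hp q hq h hX hY
    · exfalso; apply hb
      refine dom q hq fun x hx α hα β hβ => (h x hx α hα β hβ).2.trans (max_le ?_ le_rfl)
      simp only [dt_add_left, dt_smul_left]
      rw [hq1] at hX hY
      have := mul_le_mul_of_nonneg_left hX.le hα
      have := mul_le_mul_of_nonneg_left hY hβ
      linarith

end

section
variable {U : Type*} [AddCommGroup U] [Module ℝ U] {A : U → Set (ℝ × ℝ)}
open Filter Topology

lemma le_of_eps {a b k : ℝ} (h : ∀ ε : ℝ, 0 < ε → a ≤ b + ε * k) : a ≤ b := by
  by_contra hc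
  push Not at hc
  have hk : 0 < |k| + 1 := by positivity
  have h1 := h ((a - b) / (2 * (|k| + 1))) (div_pos (by linarith) (by linarith))
  have h2 : (a - b) / (2 * (|k| + 1)) * k ≤ (a - b) / (2 * (|k| + 1)) * (|k| + 1) :=
    mul_le_mul_of_nonneg_left (by linarith [le_abs_self k])
      (div_nonneg (by linarith) (by linarith))
  have h3 : (a - b) / (2 * (|k| + 1)) * (|k| + 1) = (a - b) / 2 := by field_simp
  linarith

lemma slope_eq {a b c d : ℝ} (h : ∀ t : ℝ, a + t * b ≤ c + t * d) : b = d := by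
  by_contra hne
  have hbd : b - d ≠ 0 := sub_ne_zero.mpr hne
  have := h ((c - a + 1) / (b - d))
  have h2 : (c - a + 1) / (b - d) * (b - d) = c - a + 1 := by field_simp
  linarith

lemma affine_of {f : ℝ → ℝ} (h : ∀ s t l : ℝ, 0 < l → l < 1 →
    f (l * s + (1 - l) * t) = l * f s + (1 - l) * f t) (t : ℝ) : f t = f 0 + t * (f 1 - f 0) := by
  rcases lt_trichotomy t 0 with ht | rfl | ht
  · have h1 : (0 : ℝ) < 1 - t := by linarith
    have := h t 1 (1 / (1 - t)) (by positivity) (by rw [div_lt_one h1]; linarith)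
    rw [show 1 / (1 - t) * t + (1 - 1 / (1 - t)) * 1 = 0 by field_simp; ring] at this
    field_simp at this
    linarith
  · simp
  · rcases lt_trichotomy t 1 with h1 | rfl | h1
    · have := h 1 0 t ht h1
      rw [show t * 1 + (1 - t) * 0 = t by ring] at this
      rw [this]; ring
    · ring
    · have := h t 0 (1 / t) (by positivity) (by rw [div_lt_one ht]; exact h1)
      rw [show 1 / t * t + (1 - 1 / t) * 0 = 1 by field_simp; ring] at this
      field_simp at this
      linarith

lemma tends_mul {c : ℝ} (hc : 0 < c) : Tendsto (fun τ : ℝ => c * τ) (𝓝[>] 0) (𝓝[>] 0) := by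
  apply tendsto_nhdsWithin_of_tendsto_nhds_of_eventually_within
  · have : Tendsto (fun τ : ℝ => c * τ) (𝓝 0) (𝓝 (c * 0)) := by
      apply Continuous.tendsto; fun_prop
    rw [mul_zero] at this
    exact this.mono_left nhdsWithin_le_nhds
  · filter_upwards [self_mem_nhdsWithin] with τ hτ
    exact mul_pos hc hτ

lemma Sys.h_seg (S : Sys A) {u : U} {p q : ℝ × ℝ} (hp : p ∈ A u) (hq : q ∈ A u)
    (h : ∀ x ∈ A u, ∃ t : ℝ, 0 ≤ t ∧ t ≤ 1 ∧ x = p + t • (q - p)) (w : ℝ × ℝ) :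
    hs A u w = max (dt w p) (dt w q) := by
  apply le_antisymm
  · apply S.h_le
    intro x hx
    obtain ⟨t, h0, h1, rfl⟩ := h x hx
    rw [dt_add_right, dt_smul_right, dt_sub_right]
    have a1 := le_max_left (dt w p) (dt w q)
    have a2 := le_max_right (dt w p) (dt w q)
    nlinarith
  · exact max_le (S.le_h hp w) (S.le_h hq w)

lemma Sys.upper (S : Sys A) (u0 v : U) (w : ℝ × ℝ) {τ : ℝ} (hτ : 0 < τ) :
    hs A (u0 + τ • v) w ≤ hs A u0 w + τ * hs A v w := by
  rw [← S.h_smul_left hτ]; exact S.h_add_left _ _ _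

lemma Sys.lower (S : Sys A) (u0 v : U) (w : ℝ × ℝ) {τ : ℝ} (hτ : 0 < τ) :
    hs A u0 w - τ * hs A (-v) w ≤ hs A (u0 + τ • v) w := by
  have := S.upper (u0 + τ • v) (-v) w hτ
  rw [show u0 + τ • v + τ • -v = u0 by module] at this
  linarith

lemma Sys.tend (S : Sys A) (u0 v : U) (w : ℝ × ℝ) :
    Tendsto (fun τ : ℝ => hs A (u0 + τ • v) w) (𝓝[>] 0) (𝓝 (hs A u0 w)) := by
  have t1 : Tendsto (fun τ : ℝ => hs A u0 w - τ * hs A (-v) w) (𝓝[>] 0) (𝓝 (hs A u0 w)) := by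
    have : Continuous (fun τ : ℝ => hs A u0 w - τ * hs A (-v) w) := by fun_prop
    simpa using (this.tendsto 0).mono_left (nhdsWithin_le_nhds (s := Ioi 0))
  have t2 : Tendsto (fun τ : ℝ => hs A u0 w + τ * hs A v w) (𝓝[>] 0) (𝓝 (hs A u0 w)) := by
    have : Continuous (fun τ : ℝ => hs A u0 w + τ * hs A v w) := by fun_prop
    simpa using (this.tendsto 0).mono_left (nhdsWithin_le_nhds (s := Ioi 0))
  refine tendsto_of_tendsto_of_tendsto_of_le_of_le' t1 t2 ?_ ?_
  · filter_upwards [self_mem_nhdsWithin] with τ hτ using S.lower u0 v w hτ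
  · filter_upwards [self_mem_nhdsWithin] with τ hτ using S.upper u0 v w hτ

/-- difference quotient of the support function -/
def dq (A : U → Set (ℝ × ℝ)) (u0 v : U) (w : ℝ × ℝ) (τ : ℝ) : ℝ :=
  (hs A (u0 + τ • v) w - hs A u0 w) / τ

lemma Sys.dq_mono (S : Sys A) (u0 v : U) (w : ℝ × ℝ) : MonotoneOn (dq A u0 v w) (Ioi 0) := by
  intro τ hτ σ hσ hle
  have hτ : 0 < τ := hτ
  have hσ : 0 < σ := hσ
  rcases hle.eq_or_lt with rfl | hlt
  · exact le_rfl
  unfold dq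
  have h1 := S.h_add_left ((1 - τ / σ) • u0) ((τ / σ) • (u0 + σ • v)) w
  have hr : τ / σ < 1 := (div_lt_one hσ).2 hlt
  rw [S.h_smul_left (by linarith), S.h_smul_left (div_pos hτ hσ)] at h1
  rw [show (1 - τ / σ) • u0 + (τ / σ) • (u0 + σ • v) = u0 + (τ / σ * σ) • v by module,
    div_mul_cancel₀ _ hσ.ne'] at h1
  rw [div_le_div_iff₀ hτ hσ]
  have h2 := mul_le_mul_of_nonneg_left h1 hσ.le
  have h3 : σ * ((1 - τ / σ) * hs A u0 w + τ / σ * hs A (u0 + σ • v) w)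
      = (σ - τ) * hs A u0 w + τ * hs A (u0 + σ • v) w := by field_simp
  nlinarith

lemma Sys.ex_lim (S : Sys A) (u0 v : U) (w : ℝ × ℝ) :
    ∃ g, Tendsto (dq A u0 v w) (𝓝[>] 0) (𝓝 g) := by
  refine ⟨_, (S.dq_mono u0 v w).tendsto_nhdsGT ⟨- hs A (-v) w, ?_⟩⟩
  rintro _ ⟨τ, hτ, rfl⟩
  have hτ : 0 < τ := hτ
  unfold dq
  rw [le_div_iff₀ hτ]
  linarith [S.lower u0 v w hτ]

lemma Sys.bad (S : Sys A) {b b' : ℝ × ℝ} (hD : dt b b' ≠ 0) (hP : ∀ u, PtAt A b b' u) {u0 : U}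
    (hb : ¬ Good A b b' u0) : ∃ s : U →ₗ[ℝ] (ℝ × ℝ), ∀ u, s u ∈ A u := by
  obtain ⟨p, hp, q, hq, hne, hseg⟩ := S.seg hD (hP u0) hb
  have hh := S.h_seg hp hq hseg
  obtain ⟨d, hd⟩ : ∃ d, d = q - p := ⟨_, rfl⟩
  have hd0 : d ≠ 0 := by rw [hd]; exact sub_ne_zero.mpr hne.symm
  have hdw : ∀ w, dt w d = dt w q - dt w p := fun w => by rw [hd, dt_sub_right]
  have evbad : ∀ v, ∀ᶠ τ in 𝓝[>] (0 : ℝ), ¬ Good A b b' (u0 + τ • v) := by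
    intro v
    simp only [Good, not_forall, not_le] at hb
    obtain ⟨α, β, hα, hβ, hlt⟩ := hb
    have t1 := S.tend u0 v (α • b + β • b')
    have t2 := ((S.tend u0 v b).const_mul α).add ((S.tend u0 v b').const_mul β)
    filter_upwards [t1.eventually_lt t2 hlt] with τ hτ hg
    exact absurd (hg α β hα hβ) (not_le.mpr hτ)
  have evadd : ∀ v w w', 0 < dt w d → 0 < dt w' d → ∀ᶠ τ in 𝓝[>] (0 : ℝ),
      hs A (u0 + τ • v) (w + w') = hs A (u0 + τ • v) w + hs A (u0 + τ • v) w' := by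
    intro v w w' hw hw'
    have a1 := (S.tend u0 v w).add (S.tend u0 v (-w))
    have a2 := (S.tend u0 v w').add (S.tend u0 v (-w'))
    have a3 := ((S.tend u0 v w).add (S.tend u0 v w')).sub (S.tend u0 v (w + w'))
    have k := hdw w
    have k' := hdw w'
    obtain ⟨m, hm0, hm1, hm2⟩ : ∃ m : ℝ, 0 < m ∧ m < dt w d ∧ m < dt w' d :=
      ⟨min (dt w d) (dt w' d) / 2, by positivity, by
        have := min_le_left (dt w d) (dt w' d); linarith, by
        have := min_le_right (dt w d) (dt w' d); linarith⟩
    have l1 : hs A u0 w + hs A u0 (-w) = dt w d := by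
      rw [hh, hh, dt_neg_left, dt_neg_left, max_eq_right (by linarith), max_eq_left (by linarith)]
      linarith
    have l2 : hs A u0 w' + hs A u0 (-w') = dt w' d := by
      rw [hh, hh, dt_neg_left, dt_neg_left, max_eq_right (by linarith), max_eq_left (by linarith)]
      linarith
    have l3 : hs A u0 w + hs A u0 w' - hs A u0 (w + w') = 0 := by
      rw [hh, hh, hh, dt_add_left, dt_add_left, max_eq_right (by linarith),
        max_eq_right (by linarith), max_eq_right (by linarith)]
      ring
    rw [l1] at a1
    rw [l2] at a2
    rw [l3] at a3
    filter_upwards [evbad v, a1.eventually_const_lt hm1, a2.eventually_const_lt hm2,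
      a3.eventually_lt_const hm0] with τ hbad e1 e2 e3
    obtain ⟨p', hp', q', hq', -, hseg'⟩ := S.seg hD (hP _) hbad
    have hh' := S.h_seg hp' hq' hseg'
    simp only [hh', dt_add_left, dt_neg_left] at e1 e2 e3 ⊢
    rcases le_total (dt w p') (dt w q') with c1 | c1 <;>
    rcases le_total (dt w' p') (dt w' q') with c2 | c2
    · rw [max_eq_right c1, max_eq_right c2, max_eq_right (by linarith)]
    · exfalso
      rw [max_eq_right c1, max_eq_left (by linarith)] at e1
      rw [max_eq_left c2, max_eq_right (by linarith)] at e2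
      rw [max_eq_right c1, max_eq_left c2] at e3
      rcases le_total (dt w p' + dt w' p') (dt w q' + dt w' q') with c | c
      · rw [max_eq_right c] at e3; linarith
      · rw [max_eq_left c] at e3; linarith
    · exfalso
      rw [max_eq_left c1, max_eq_right (by linarith)] at e1
      rw [max_eq_right c2, max_eq_left (by linarith)] at e2
      rw [max_eq_left c1, max_eq_right c2] at e3
      rcases le_total (dt w p' + dt w' p') (dt w q' + dt w' q') with c | c
      · rw [max_eq_right c] at e3; linarith
      · rw [max_eq_left c] at e3; linarith
    · rw [max_eq_left c1, max_eq_left c2, max_eq_left (by linarith)]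
  choose g hg using fun v w => S.ex_lim u0 v w
  have g_le : ∀ v w, g v w ≤ hs A v w := by
    intro v w
    refine le_of_tendsto (hg v w) ?_
    filter_upwards [self_mem_nhdsWithin] with τ hτ
    have hτ : 0 < τ := hτ
    unfold dq
    rw [div_le_iff₀ hτ]
    linarith [S.upper u0 v w hτ]
  have g_add : ∀ v v' w, g (v + v') w ≤ g v w + g v' w := by
    intro v v' w
    refine le_of_tendsto_of_tendsto (hg (v + v') w)
      (((hg v w).comp (tends_mul two_pos)).add ((hg v' w).comp (tends_mul two_pos))) ?_
    filter_upwards [self_mem_nhdsWithin] with τ hτ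
    have hτ : 0 < τ := hτ
    simp only [Function.comp_apply, dq]
    have h1 := S.h_add_left ((1 / 2 : ℝ) • (u0 + (2 * τ) • v)) ((1 / 2 : ℝ) • (u0 + (2 * τ) • v')) w
    rw [S.h_smul_left (by norm_num), S.h_smul_left (by norm_num),
      show (1 / 2 : ℝ) • (u0 + (2 * τ) • v) + (1 / 2 : ℝ) • (u0 + (2 * τ) • v') =
        u0 + τ • (v + v') by module] at h1
    rw [← add_div, div_le_div_iff₀ hτ (by linarith)]
    nlinarith
  have g_smul : ∀ c : ℝ, 0 < c → ∀ v w, g (c • v) w = c * g v w := by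
    intro c hc v w
    refine tendsto_nhds_unique (hg (c • v) w)
      ((((hg v w).comp (tends_mul hc)).const_mul c).congr' ?_)
    filter_upwards [self_mem_nhdsWithin] with τ hτ
    have hτ : 0 < τ := hτ
    simp only [Function.comp_apply, dq, smul_smul]
    rw [mul_comm τ c]
    field_simp
  have g_wsmul : ∀ c : ℝ, 0 < c → ∀ v w, g v (c • w) = c * g v w := by
    intro c hc v w
    refine tendsto_nhds_unique (hg v (c • w)) (((hg v w).const_mul c).congr' ?_)
    filter_upwards with τ
    simp only [dq, S.h_smul_right hc.le]
    ring
  have g_wadd : ∀ v w w', 0 < dt w d → 0 < dt w' d → g v (w + w') = g v w + g v w' := by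
    intro v w w' hw hw'
    refine tendsto_nhds_unique (hg v (w + w')) (((hg v w).add (hg v w')).congr' ?_)
    have h0 : hs A u0 (w + w') = hs A u0 w + hs A u0 w' := by
      have k := hdw w
      have k' := hdw w'
      rw [hh, hh, hh, dt_add_left, dt_add_left, max_eq_right (by linarith),
        max_eq_right (by linarith), max_eq_right (by linarith)]
    filter_upwards [evadd v w w' hw hw'] with τ hτ
    simp only [dq, hτ, h0]
    ring
  -- the transversal vector
  have hdn : 0 < d.1 ^ 2 + d.2 ^ 2 := by
    by_contra hc
    apply hd0
    have h1 : d.1 = 0 := by nlinarith [sq_nonneg d.1, sq_nonneg d.2]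
    have h2 : d.2 = 0 := by nlinarith [sq_nonneg d.1, sq_nonneg d.2]
    ext <;> simp [h1, h2]
  obtain ⟨e, he⟩ : ∃ e, dt e d = 1 := by
    refine ⟨(d.2 / (d.1 ^ 2 + d.2 ^ 2), - d.1 / (d.1 ^ 2 + d.2 ^ 2)), ?_⟩
    simp only [dt]; field_simp; ring
  have hdd : dt d d = 0 := by simp [dt]; ring
  have hed : ∀ t : ℝ, dt (e + t • d) d = 1 := by
    intro t; rw [dt_add_left, dt_smul_left, hdd, he]; ring
  set x : U → ℝ := fun v => g v (e + (1 : ℝ) • d) - g v (e + (0 : ℝ) • d) with hx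
  have hG : ∀ v (t : ℝ), g v (e + t • d) = g v (e + (0 : ℝ) • d) + t * x v := by
    intro v t
    refine affine_of (f := fun t => g v (e + t • d)) (fun s t l hl0 hl1 => ?_) t
    have := g_wadd v (l • (e + s • d)) ((1 - l) • (e + t • d))
      (by rw [dt_smul_left, hed]; linarith) (by rw [dt_smul_left, hed]; linarith)
    rw [g_wsmul l hl0, g_wsmul (1 - l) (by linarith)] at this
    rw [← this]
    congr 1
    module
  have x_add : ∀ v v', x (v + v') = x v + x v' := by
    intro v v'
    refine slope_eq (a := g (v + v') (e + (0 : ℝ) • d))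
      (c := g v (e + (0 : ℝ) • d) + g v' (e + (0 : ℝ) • d)) fun t => ?_
    have := g_add v v' (e + t • d)
    rw [hG, hG v, hG v'] at this
    linarith
  have x_pos : ∀ c : ℝ, 0 < c → ∀ v, x (c • v) = c * x v := by
    intro c hc v
    simp only [hx, g_smul c hc]; ring
  have x_zero : x 0 = 0 := by have := x_add 0 0; rw [add_zero] at this; linarith
  have x_neg : ∀ v, x (-v) = - x v := by
    intro v; have := x_add v (-v); rw [add_neg_cancel, x_zero] at this; linarith
  have x_smul : ∀ (c : ℝ) v, x (c • v) = c * x v := by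
    intro c v
    rcases lt_trichotomy c 0 with h | rfl | h
    · have := x_pos (-c) (by linarith) v
      rw [neg_smul, x_neg] at this; linarith
    · simp [x_zero]
    · exact x_pos c h v
  let xl : U →ₗ[ℝ] ℝ := { toFun := x, map_add' := x_add, map_smul' := fun c v => x_smul c v }
  obtain ⟨y, -, hy⟩ := exists_extension_of_le_sublinear
    (⟨⊥, 0⟩ : U →ₗ.[ℝ] ℝ) (fun v => g v (e + (0 : ℝ) • d))
    (fun c hc v => g_smul c hc v _) (fun v v' => g_add v v' _) (by
      rintro ⟨v, hv⟩
      have hv0 : v = 0 := by simpa using hv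
      subst hv0
      have := g_smul 2 (by norm_num) 0 (e + (0 : ℝ) • d)
      rw [smul_zero] at this
      have h0 : g 0 (e + (0 : ℝ) • d) = 0 := by linarith
      simp only [h0]
      simp)
  let s : U →ₗ[ℝ] (ℝ × ℝ) := y.smulRight d - xl.smulRight e
  have hsv : ∀ v, s v = y v • d - x v • e := fun v => rfl
  have hde : dt d e = -1 := by simp only [dt] at he ⊢; linarith
  have hee : dt e e = 0 := by simp [dt]; ring
  have pos : ∀ v w, 0 < dt w d → dt w (s v) ≤ hs A v w := by
    intro v w hw
    have hwe : w = dt w d • (e + (dt e w / dt w d) • d) := by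
      rw [smul_add, smul_smul, mul_div_cancel₀ _ hw.ne']
      simp only [dt] at he ⊢
      ext
      · simp only [Prod.fst_add, Prod.smul_fst, smul_eq_mul]; linear_combination (- w.1) * he
      · simp only [Prod.snd_add, Prod.smul_snd, smul_eq_mul]; linear_combination (- w.2) * he
    refine le_trans ?_ (g_le v w)
    set α := dt w d
    set t := dt e w / α
    rw [hwe, g_wsmul α hw, hG, dt_smul_left]
    refine mul_le_mul_of_nonneg_left ?_ hw.le
    rw [hsv, dt_sub_right, dt_smul_right, dt_smul_right, hed, dt_add_left, dt_smul_left, hde, hee]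
    have := hy v
    linarith
  have nz : ∀ v w, dt w d ≠ 0 → dt w (s v) ≤ hs A v w := by
    intro v w hw
    rcases lt_or_gt_of_ne hw with h | h
    · have := pos (-v) (-w) (by rw [dt_neg_left]; linarith)
      rw [S.h_neg_left, neg_neg, map_neg, dt_neg_left, dt_neg_right, neg_neg] at this
      exact this
    · exact pos v w h
  refine ⟨s, fun v => S.mem_of fun w => ?_⟩
  by_cases hw : dt w d = 0
  · refine le_of_eps (k := hs A v e - dt e (s v)) fun ε hε => ?_
    have h1 := pos v (w + ε • e) (by rw [dt_add_left, dt_smul_left, hw, he]; linarith)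
    have h2 := S.h_add_right v w (ε • e)
    rw [S.h_smul_right hε.le] at h2
    rw [dt_add_left, dt_smul_left] at h1
    linarith
  · exact nz v w hw

end

section
variable {U : Type*} [AddCommGroup U] [Module ℝ U] {A : U → Set (ℝ × ℝ)}

/-- abstract main theorem -/
theorem Sys.main (S : Sys A) {q s : ℝ} (hs0 : 0 < s) (hsq : s < q)
    (h0 : ∀ u, PtAt A (1, 0) (0, 1) u) (h1 : ∀ u, PtAt A (0, 1) (-1, q) u)
    (h2 : ∀ u, PtAt A (-1, q) (-1, s) u) (h3 : ∀ u, PtAt A (-1, s) (-1, 0) u) :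
    ∃ f : U →ₗ[ℝ] ℝ × ℝ, ∀ u, f u ∈ A u := by
  have hq : 0 < q := hs0.trans hsq
  by_cases g0 : ∀ u, Good A (1, 0) (0, 1) u
  swap
  · push Not at g0; obtain ⟨u, hu⟩ := g0
    exact S.bad (by simp [dt]) h0 hu
  by_cases g1 : ∀ u, Good A (0, 1) (-1, q) u
  swap
  · push Not at g1; obtain ⟨u, hu⟩ := g1
    exact S.bad (by simp [dt]) h1 hu
  by_cases g2 : ∀ u, Good A (-1, q) (-1, s) u
  swap
  · push Not at g2; obtain ⟨u, hu⟩ := g2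
    exact S.bad (by simp only [dt]; intro h; linarith) h2 hu
  by_cases g3 : ∀ u, Good A (-1, s) (-1, 0) u
  swap
  · push Not at g3; obtain ⟨u, hu⟩ := g3
    exact S.bad (by simp only [dt]; intro h; linarith) h3 hu
  obtain ⟨f, hf⟩ := S.select4 (p2 := -1) (q2 := q) (p3 := -1) (q3 := s) (by norm_num) hq.ne'
    (by norm_num) hs0.ne'
  refine ⟨f, ?_⟩
  have hneg : ∀ w : ℝ × ℝ, (∀ u, dt w (f u) ≤ hs A u w) → ∀ u, dt (-w) (f u) ≤ hs A u (-w) := by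
    intro w h u
    have := h (-u)
    rw [S.h_neg_left, map_neg, dt_neg_right] at this
    rw [dt_neg_left]; exact this
  have hcomb : ∀ b b' : ℝ × ℝ, (∀ u, Good A b b' u) → (∀ u, dt b (f u) ≤ hs A u b) →
      (∀ u, dt b' (f u) ≤ hs A u b') → ∀ α β : ℝ, 0 ≤ α → 0 ≤ β → ∀ u,
      dt (α • b + β • b') (f u) ≤ hs A u (α • b + β • b') := by
    intro b b' g hb hb' α β ha hbt u
    have := g u α β ha hbt
    rw [dt_add_left, dt_smul_left, dt_smul_left]
    nlinarith [mul_le_mul_of_nonneg_left (hb u) ha, mul_le_mul_of_nonneg_left (hb' u) hbt]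
  have c0 := fun u => (hf u).1
  have c1 := fun u => (hf u).2.1
  have c2 := fun u => (hf u).2.2.1
  have c3 := fun u => (hf u).2.2.2
  have c4 : ∀ u, dt (-1, 0) (f u) ≤ hs A u (-1, 0) := by
    have := hneg _ c0
    simpa using this
  have key : ∀ X Y : ℝ, X ≤ 0 → ∀ u, dt (X, Y) (f u) ≤ hs A u (X, Y) := by
    intro X Y hX
    rcases le_total Y 0 with hY | hY
    · have := hneg _ (hcomb _ _ g0 c0 c1 (-X) (-Y) (by linarith) (by linarith))
      simpa using this
    rcases le_total Y (-(s * X)) with h | h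
    · have := hcomb _ _ g3 c3 c4 (Y / s) (-X - Y / s) (by positivity) (by
        rw [sub_nonneg, div_le_iff₀ hs0]; linarith)
      have e : ((Y / s) • ((-1 : ℝ), s) + (-X - Y / s) • ((-1 : ℝ), (0 : ℝ))) = (X, Y) := by
        ext <;> simp; field_simp
      rwa [e] at this
    rcases le_total Y (-(q * X)) with h' | h'
    · have hqs : 0 < q - s := by linarith
      have := hcomb _ _ g2 c2 c3 ((Y + s * X) / (q - s)) ((-(q * X) - Y) / (q - s))
        (div_nonneg (by linarith) hqs.le) (div_nonneg (by linarith) hqs.le)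
      have e : (((Y + s * X) / (q - s)) • ((-1 : ℝ), q) + ((-(q * X) - Y) / (q - s)) • ((-1 : ℝ), s))
          = (X, Y) := by
        ext <;> simp <;> field_simp <;> ring
      rwa [e] at this
    · have := hcomb _ _ g1 c1 c2 (Y + q * X) (-X) (by linarith) (by linarith)
      have e : ((Y + q * X) • ((0 : ℝ), (1 : ℝ)) + (-X) • ((-1 : ℝ), q)) = (X, Y) := by
        ext <;> simp; ring
      rwa [e] at this
  intro u
  apply S.mem_of
  rintro ⟨X, Y⟩
  rcases le_total X 0 with h | h
  · exact key X Y h u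
  · have := hneg _ (key (-X) (-Y) (by linarith)) u
    simpa using this
end


/-- one of the two open double cones spanned by two vectors lies in `J` -/
def Alt (J : Set (ℝ × ℝ)) (b b' : ℝ × ℝ) : Prop :=
  (∀ x y : ℝ, 0 < x → 0 < y → x • b + y • b' ∈ J) ∨
  (∀ x y : ℝ, 0 < x → 0 < y → x • b - y • b' ∈ J)

lemma Alt.right {J : Set (ℝ × ℝ)} {b b' : ℝ × ℝ} {c : ℝ} (hc : c ≠ 0) (h : Alt J b (c • b')) :
    Alt J b b' := by
  have key : ∀ x y : ℝ, y • b' = (y / c) • (c • b') := by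
    intro x y; rw [smul_smul, div_mul_cancel₀ _ hc]
  have key' : ∀ x y : ℝ, y • b' = -((y / -c) • (c • b')) := by
    intro x y; rw [smul_smul, ← neg_smul]; congr 1; field_simp
  rcases lt_or_gt_of_ne hc with hc | hc
  · rcases h with h | h
    · right
      intro x y hx hy
      have := h x (y / -c) hx (div_pos hy (by linarith))
      rw [key' x y, sub_neg_eq_add]; exact this
    · left
      intro x y hx hy
      have := h x (y / -c) hx (div_pos hy (by linarith))
      rw [key' x y, ← sub_eq_add_neg]; exact this
  · rcases h with h | h
    · left
      intro x y hx hy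
      rw [key x y]; exact h x (y / c) hx (div_pos hy hc)
    · right
      intro x y hx hy
      rw [key x y]; exact h x (y / c) hx (div_pos hy hc)

lemma Alt.symm {J : Set (ℝ × ℝ)} (hJ : ∀ x ∈ J, -x ∈ J) {b b' : ℝ × ℝ} (h : Alt J b b') :
    Alt J b' b := by
  rcases h with h | h
  · left; intro x y hx hy; rw [add_comm]; exact h y x hy hx
  · right; intro x y hx hy
    have := hJ _ (h y x hy hx)
    rwa [neg_sub] at this

lemma arcs {J0 J1 J2 J3 : Set (ℝ × ℝ)} {q s : ℝ} (hq : q ≠ 0) (hs : s ≠ 0) (hqs : s ≠ q)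
    (n0 : ∀ x ∈ J0, -x ∈ J0)
    (d01 : Disjoint J0 J1) (d03 : Disjoint J0 J3) (d12 : Disjoint J1 J2) (d13 : Disjoint J1 J3)
    (h0 : ∀ x y : ℝ, 0 < x → 0 < y → (x, y) ∈ J0)
    (h1 : Alt J1 (0, 1) (-1, q)) (h2 : Alt J2 (-1, q) (-1, s)) (h3 : Alt J3 (-1, s) (1, 0)) :
    0 < s ∧ s < q ∧
    (∀ x y : ℝ, 0 < x → 0 < y → x • ((0 : ℝ), (1 : ℝ)) + y • ((-1 : ℝ), q) ∈ J1) ∧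
    (∀ x y : ℝ, 0 < x → 0 < y → x • ((-1 : ℝ), q) + y • ((-1 : ℝ), s) ∈ J2) ∧
    (∀ x y : ℝ, 0 < x → 0 < y → x • ((-1 : ℝ), s) + y • ((-1 : ℝ), (0 : ℝ)) ∈ J3) := by
  have h0' : ∀ x y : ℝ, x < 0 → y < 0 → (x, y) ∈ J0 := by
    intro x y hx hy
    have := n0 _ (h0 (-x) (-y) (by linarith) (by linarith))
    simpa using this
  have hq0 : 0 < q := by
    by_contra hneg
    have hq' : q < 0 := lt_of_le_of_ne (not_lt.mp hneg) hq
    rcases h1 with h | h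
    · have := h (-q/2) 1 (by linarith) one_pos
      refine disjoint_left.mp d01 (h0' _ _ ?_ ?_) this <;> simp <;> linarith
    · have := h 1 1 one_pos one_pos
      refine disjoint_left.mp d01 (h0 _ _ ?_ ?_) this <;> simp; linarith
  have r1 : ∀ x y : ℝ, 0 < x → 0 < y → x • ((0 : ℝ), (1 : ℝ)) + y • ((-1 : ℝ), q) ∈ J1 := by
    rcases h1 with h | h
    · exact h
    · exfalso
      have := h (2 * q) 1 (by linarith) one_pos
      refine disjoint_left.mp d01 (h0 _ _ ?_ ?_) this <;> simp; linarith
  have hs0 : 0 < s := by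
    by_contra hneg
    have hs' : s < 0 := lt_of_le_of_ne (not_lt.mp hneg) hs
    rcases h3 with h | h
    · have := h 2 1 two_pos one_pos
      refine disjoint_left.mp d03 (h0' _ _ ?_ ?_) this <;> simp <;> linarith
    · have := h 1 1 one_pos one_pos
      refine disjoint_left.mp d03 (h0' _ _ ?_ ?_) this <;> simp <;> linarith
  have r3 : ∀ x y : ℝ, 0 < x → 0 < y → x • ((-1 : ℝ), s) + y • ((-1 : ℝ), (0 : ℝ)) ∈ J3 := by
    rcases h3 with h | h
    · exfalso
      have := h 1 2 one_pos two_pos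
      refine disjoint_left.mp d03 (h0 _ _ ?_ ?_) this <;> simp <;> linarith
    · intro x y hx hy
      have := h x y hx hy
      simpa [sub_eq_add_neg] using this
  have hsq : s < q := by
    by_contra hneg
    have hs' : q < s := lt_of_le_of_ne (not_lt.mp hneg) hqs.symm
    have m3 := r3 (2 * q) (s - q) (by linarith) (by linarith)
    have m1 := r1 (q * (s - q)) (2 * q + (s - q)) (by nlinarith) (by nlinarith)
    refine disjoint_left.mp d13 m1 ?_
    convert m3 using 1
    ext <;> simp <;> ring
  refine ⟨hs0, hsq, r1, ?_, r3⟩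
  rcases h2 with h | h
  · exact h
  · exfalso
    have m2 := h 2 1 two_pos one_pos
    have m1 := r1 (q - s) 1 (by linarith) one_pos
    refine disjoint_left.mp d12 m1 ?_
    convert m2 using 1
    ext <;> simp <;> ring

section

/-- membership of the class of a vector in a projective set -/
def pm (A : Set (Projectivization ℝ M)) (v : M) : Prop :=
  ∃ h : v ≠ 0, Projectivization.mk ℝ v h ∈ A

lemma pm.ne {A : Set (Projectivization ℝ M)} {v : M} (h : pm A v) : v ≠ 0 := h.1

lemma pm_smul {A : Set (Projectivization ℝ M)} {v : M} {c : ℝ} (hc : c ≠ 0) :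
    pm A (c • v) ↔ pm A v := by
  have e : ∀ (h : v ≠ 0) (h' : c • v ≠ 0),
      Projectivization.mk ℝ (c • v) h' = Projectivization.mk ℝ v h := fun h h' =>
    (Projectivization.mk_eq_mk_iff' ℝ _ _ _ _).mpr ⟨c, rfl⟩
  constructor
  · rintro ⟨h, hm⟩
    have hv : v ≠ 0 := fun h0 => h (by rw [h0, smul_zero])
    exact ⟨hv, by rwa [← e hv h]⟩
  · rintro ⟨h, hm⟩
    exact ⟨smul_ne_zero hc h, by rwa [e h]⟩

lemma pm_neg {A : Set (Projectivization ℝ M)} {v : M} : pm A (-v) ↔ pm A v := by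
  have := pm_smul (A := A) (v := v) (c := -1) (by norm_num)
  rwa [neg_one_smul] at this

lemma pm_rep {A : Set (Projectivization ℝ M)} {x : Projectivization ℝ M} :
    pm A x.rep ↔ x ∈ A := by
  constructor
  · rintro ⟨h, hm⟩; rwa [Projectivization.mk_rep] at hm
  · intro h; exact ⟨x.rep_nonzero, by rwa [Projectivization.mk_rep]⟩

lemma ex_rep {v : M} (h : v ≠ 0) :
    ∃ c : ℝ, c ≠ 0 ∧ (Projectivization.mk ℝ v h).rep = c • v := by
  obtain ⟨a, ha⟩ := Projectivization.exists_smul_eq_mk_rep ℝ v h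
  exact ⟨a, a.ne_zero, ha.symm⟩

lemma mk_mem_projSet {W : Submodule ℝ M} {v : M} (h : v ≠ 0) :
    Projectivization.mk ℝ v h ∈ projSet W ↔ v ∈ W := by
  obtain ⟨c, hc, e⟩ := ex_rep h
  show _ ∈ W ↔ _
  rw [e]; exact W.smul_mem_iff hc

lemma pm_inter {A B : Set (Projectivization ℝ M)} {v : M} :
    pm (A ∩ B) v ↔ pm A v ∧ pm B v :=
  ⟨fun ⟨h, a, b⟩ => ⟨⟨h, a⟩, ⟨h, b⟩⟩, fun ⟨⟨h, a⟩, ⟨_, b⟩⟩ => ⟨h, a, b⟩⟩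

lemma pm_projSet {W : Submodule ℝ M} {v : M} (h : v ≠ 0) : pm (projSet W) v ↔ v ∈ W :=
  ⟨fun ⟨_, a⟩ => (mk_mem_projSet h).mp a, fun a => ⟨h, (mk_mem_projSet h).mpr a⟩⟩

lemma pm_compl {A : Set (Projectivization ℝ M)} {v : M} (h : v ≠ 0) : pm Aᶜ v ↔ ¬ pm A v :=
  ⟨fun ⟨_, a⟩ ⟨_, b⟩ => a b, fun a => ⟨h, fun b => a ⟨h, b⟩⟩⟩

lemma IsProjConvex.pm {A : Set (Projectivization ℝ M)} (hA : IsProjConvex A) :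
    ∃ φ : Module.Dual ℝ M, (∀ v, pm A v → φ v ≠ 0) ∧
      ∀ v w, CC.pm A v → CC.pm A w → 0 < φ v * φ w → CC.pm A (v + w) := by
  obtain ⟨φ, -, h1, h2⟩ := hA
  have hne : ∀ v, CC.pm A v → φ v ≠ 0 := by
    rintro v ⟨h, hm⟩ h0
    obtain ⟨c, hc, e⟩ := ex_rep h
    apply h1 _ hm
    rw [e, map_smul, h0, smul_zero]
  refine ⟨φ, hne, ?_⟩
  have hch : ∀ v, CC.pm A v → (φ v)⁻¹ • v ∈ projChart φ '' A := by
    rintro v ⟨h, hm⟩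
    refine ⟨_, hm, ?_⟩
    obtain ⟨c, hc, e⟩ := ex_rep h
    have := hne v ⟨h, hm⟩
    rw [projChart, e, map_smul, smul_smul, smul_eq_mul]
    congr 1; field_simp
  intro v w hv hw hp
  have hv0 := hne v hv
  have hw0 := hne w hw
  have hs : φ v + φ w ≠ 0 := by
    intro h0
    have : φ w = - φ v := by linarith
    rw [this] at hp; nlinarith [mul_self_nonneg (φ v)]
  have hd : ∀ p q : ℝ, 0 < p * q → 0 ≤ p / (p + q) := by
    intro p q h
    rcases pos_and_pos_or_neg_and_neg_of_mul_pos h with ⟨h1, h2⟩ | ⟨h1, h2⟩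
    · positivity
    · exact div_nonneg_of_nonpos h1.le (by linarith)
  have ha : 0 ≤ φ v / (φ v + φ w) := hd _ _ hp
  have hb : 0 ≤ φ w / (φ v + φ w) := by
    rw [add_comm]; exact hd _ _ (by rwa [mul_comm])
  have := h2 (hch v hv) (hch w hw) ha hb (by field_simp)
  obtain ⟨x, hx, e⟩ := this
  have hx0 := h1 x hx
  have e2 : x.rep = (φ x.rep / (φ v + φ w)) • (v + w) := by
    rw [projChart] at e
    generalize φ x.rep = c at e hx0 ⊢
    have : x.rep = c • (c⁻¹ • x.rep) := by
      rw [smul_smul, mul_inv_cancel₀ hx0, one_smul]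
    rw [this, e]
    rw [smul_add, smul_add, smul_smul, smul_smul, smul_smul, smul_smul]
    congr 2 <;> field_simp
  have h3 := pm_rep.mpr hx
  rw [e2] at h3
  exact (pm_smul (div_ne_zero hx0 hs)).mp h3

lemma pm_projImage {T : Submodule ℝ M} {A : Set (Projectivization ℝ M)} {v : M}
    (hT : ∀ x, pm A x → x ∉ T) (hv : v ∉ T) :
    pm (projImage T A)ᶜ (T.mkQ v) ↔ ∀ w ∈ T, ¬ pm A (v + w) := by
  have h0 : T.mkQ v ≠ 0 := by simpa using hv
  rw [pm_compl h0]
  constructor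
  · rintro h w hw ⟨hx, hm⟩
    apply h
    refine ⟨h0, _, hm, fun hr => hT _ (pm_rep.mpr hm) hr, ?_⟩
    obtain ⟨c, hc, e⟩ := ex_rep hx
    rw [Projectivization.submodule_mk, e, Submodule.mem_span_singleton]
    refine ⟨c, ?_⟩
    have : T.mkQ w = 0 := by simpa using hw
    rw [map_smul, map_add, this, add_zero]
  · rintro h ⟨_, x, hx, hxT, hm⟩
    rw [Projectivization.submodule_mk, Submodule.mem_span_singleton] at hm
    obtain ⟨c, hc⟩ := hm
    have hc0 : c ≠ 0 := by
      rintro rfl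
      apply hxT
      rw [zero_smul] at hc
      simpa using hc.symm
    have hw : x.rep - c • v ∈ T := by
      rw [← Submodule.ker_mkQ T, LinearMap.mem_ker, map_sub, map_smul, hc, sub_self]
    apply h (c⁻¹ • (x.rep - c • v)) (T.smul_mem _ hw)
    rw [smul_sub, smul_smul, inv_mul_cancel₀ hc0, one_smul, add_sub_cancel,
      pm_smul (inv_ne_zero hc0)]
    exact pm_rep.mpr hx
end

section
variable {n : ℕ}

/-- the section of the cone of `A` over `u` -/
def Sec (A : Set (Pt n)) (ι : ℝ × ℝ →ₗ[ℝ] Vec n) (U : Submodule ℝ (Vec n)) (u : U) :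
    Set (ℝ × ℝ) := {x | (u : Vec n) + ι x = 0 ∨ pm A (u + ι x)}

/-- coordinates -/
structure Cor (W : Submodule ℝ (Vec n)) (A : Set (Pt n)) (ι : ℝ × ℝ →ₗ[ℝ] Vec n)
    (U : Submodule ℝ (Vec n)) : Prop where
  inj : Function.Injective ι
  rng : LinearMap.range ι = W
  cpl : IsCompl U W
  fr : finrank ℝ W = 2
  cc : IsLConvexConcave W A

variable {W : Submodule ℝ (Vec n)} {A : Set (Pt n)} {ι : ℝ × ℝ →ₗ[ℝ] Vec n}
    {U : Submodule ℝ (Vec n)}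

lemma Cor.mem (C : Cor W A ι U) (x : ℝ × ℝ) : ι x ∈ W := by rw [← C.rng]; exact ⟨x, rfl⟩

lemma Cor.ex (C : Cor W A ι U) {w : Vec n} (h : w ∈ W) : ∃ x, ι x = w := by
  rw [← C.rng] at h; exact h

lemma Cor.notW (C : Cor W A ι U) {v : Vec n} (h : pm A v) : v ∉ W := by
  obtain ⟨h0, hm⟩ := h
  intro hv
  exact C.cc.2.1 _ hm ((mk_mem_projSet h0).mpr hv)

/-- projection to `U` -/
def Cor.pr (C : Cor W A ι U) : Vec n →ₗ[ℝ] U := U.projectionOnto W C.cpl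

lemma Cor.pr_u (C : Cor W A ι U) (u : U) : C.pr (u : Vec n) = u :=
  Submodule.projectionOnto_apply_left C.cpl u
lemma Cor.pr_zero (C : Cor W A ι U) {v : Vec n} : C.pr v = 0 ↔ v ∈ W :=
  Submodule.projectionOnto_apply_eq_zero_iff C.cpl
lemma Cor.pr_ι (C : Cor W A ι U) (x : ℝ × ℝ) : C.pr (ι x) = 0 := C.pr_zero.mpr (C.mem x)

lemma Cor.uW (C : Cor W A ι U) {u : U} (hu : u ≠ 0) (x : ℝ × ℝ) : (u : Vec n) + ι x ∉ W := by
  rw [← C.pr_zero, map_add, C.pr_u, C.pr_ι, add_zero]; exact hu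

lemma Cor.u0 (C : Cor W A ι U) {u : U} (hu : u ≠ 0) (x : ℝ × ℝ) : (u : Vec n) + ι x ≠ 0 := by
  intro h; apply C.uW hu x; rw [h]; exact W.zero_mem

lemma Cor.sec_iff (C : Cor W A ι U) {u : U} (hu : u ≠ 0) (x : ℝ × ℝ) :
    x ∈ Sec A ι U u ↔ pm A (u + ι x) :=
  ⟨fun h => h.resolve_left (C.u0 hu x), fun h => Or.inr h⟩

lemma Cor.sec_zero (C : Cor W A ι U) (x : ℝ × ℝ) : x ∈ Sec A ι U 0 ↔ x = 0 := by
  constructor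
  · rintro (h | h)
    · have : ι x = ι 0 := by simpa using h
      exact C.inj this
    · exfalso; apply C.notW h; simpa using C.mem x
  · rintro rfl; left; simp

lemma Cor.zero_eq (C : Cor W A ι U) : Sec A ι U 0 = {0} := by
  ext x; rw [C.sec_zero]; rfl

/-- the plane through `L` and `u` -/
def NN (W U : Submodule ℝ (Vec n)) (u : U) : Submodule ℝ (Vec n) := W ⊔ Submodule.span ℝ {(u : Vec n)}

lemma Cor.NN_fr (C : Cor W A ι U) {u : U} (hu : u ≠ 0) : finrank ℝ (NN W U u) = 3 := by
  have h := Submodule.finrank_sup_add_finrank_inf_eq W (Submodule.span ℝ {(u : Vec n)})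
  have hu' : (u : Vec n) ≠ 0 := by simpa using hu
  have hd : W ⊓ Submodule.span ℝ {(u : Vec n)} = ⊥ := by
    rw [eq_bot_iff]
    rintro v ⟨h1, h2⟩
    obtain ⟨c, rfl⟩ := Submodule.mem_span_singleton.mp h2
    have h1 : c • (u : Vec n) ∈ W := h1
    rw [← C.pr_zero, map_smul, C.pr_u, smul_eq_zero] at h1
    rcases h1 with h | h
    · simp [h]
    · exact absurd h hu
  rw [hd, finrank_bot, C.fr, finrank_span_singleton hu'] at h
  exact h

lemma Cor.NN_mem (C : Cor W A ι U) {u : U} {v : Vec n} :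
    v ∈ NN W U u ↔ ∃ (c : ℝ) (x : ℝ × ℝ), v = c • (u : Vec n) + ι x := by
  rw [NN, Submodule.mem_sup]
  constructor
  · rintro ⟨y, hy, z, hz, rfl⟩
    obtain ⟨c, rfl⟩ := Submodule.mem_span_singleton.mp hz
    obtain ⟨x, rfl⟩ := C.ex hy
    exact ⟨c, x, add_comm _ _⟩
  · rintro ⟨c, x, rfl⟩
    exact ⟨_, C.mem x, _, Submodule.mem_span_singleton.mpr ⟨c, rfl⟩, add_comm _ _⟩

lemma Cor.ex_sec (C : Cor W A ι U) {u : U} {v : Vec n} (hv : pm A v)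
    (hN : v ∈ NN W U u) : ∃ (c : ℝ) (x : ℝ × ℝ), c ≠ 0 ∧ v = c • ((u : Vec n) + ι x) ∧
      x ∈ Sec A ι U u := by
  obtain ⟨c, x, rfl⟩ := C.NN_mem.mp hN
  have hc : c ≠ 0 := by
    rintro rfl
    apply C.notW hv
    simpa using C.mem x
  have e : c • (u : Vec n) + ι x = c • ((u : Vec n) + ι (c⁻¹ • x)) := by
    rw [map_smul, smul_add, smul_smul, mul_inv_cancel₀ hc, one_smul]
  refine ⟨c, c⁻¹ • x, hc, e, Or.inr ?_⟩
  rw [e, pm_smul hc] at hv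
  exact hv

lemma Cor.ne (C : Cor W A ι U) (u : U) : (Sec A ι U u).Nonempty := by
  by_cases hu : u = 0
  · subst hu; exact ⟨0, (C.sec_zero 0).mpr rfl⟩
  · obtain ⟨x, hxA, hxN⟩ := (C.cc.2.2.1 (NN W U u) le_sup_left (by rw [C.NN_fr hu, C.fr])).1
    obtain ⟨c, y, -, -, hy⟩ := C.ex_sec (pm_rep.mpr hxA) hxN
    exact ⟨y, hy⟩

lemma Cor.conv (C : Cor W A ι U) (u : U) : Convex ℝ (Sec A ι U u) := by
  by_cases hu : u = 0
  · subst hu; rw [C.zero_eq]; exact convex_singleton 0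
  obtain ⟨φ, h1, h2⟩ := (C.cc.2.2.1 (NN W U u) le_sup_left (by rw [C.NN_fr hu, C.fr])).2.pm
  have hN : ∀ x ∈ Sec A ι U u, pm (A ∩ projSet (NN W U u)) (u + ι x) := by
    intro x hx
    refine pm_inter.mpr ⟨(C.sec_iff hu x).mp hx, (pm_projSet (C.u0 hu x)).mpr ?_⟩
    exact C.NN_mem.mpr ⟨1, x, by rw [one_smul]⟩
  rw [convex_iff_forall_pos]
  intro x hx y hy a b ha hb hab
  have hx' := hN x hx
  have hy' := hN y hy
  have hp : 0 < φ (u + ι x) * φ (u + ι y) := by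
    rcases lt_or_gt_of_ne (mul_ne_zero (h1 _ hx') (h1 _ hy')) with h | h
    · exfalso
      have := h2 _ _ hx' (pm_neg.mpr hy') (by rw [map_neg]; linarith)
      apply C.notW (pm_inter.mp this).1
      have e : (u : Vec n) + ι x + -((u : Vec n) + ι y) = ι (x - y) := by
        rw [map_sub]; abel
      rw [e]; exact C.mem _
    · exact h
  have := h2 _ _ ((pm_smul ha.ne').mpr hx') ((pm_smul hb.ne').mpr hy') (by
    rw [map_smul, map_smul, smul_eq_mul, smul_eq_mul]
    have := mul_pos (mul_pos ha hb) hp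
    linarith)
  rw [C.sec_iff hu]
  have e : a • ((u : Vec n) + ι x) + b • ((u : Vec n) + ι y) = (u : Vec n) + ι (a • x + b • y) := by
    obtain rfl : b = 1 - a := by linarith
    rw [map_add, map_smul, map_smul]
    module
  rw [e] at this
  exact (pm_inter.mp this).1

lemma Cor.smul (C : Cor W A ι U) (c : ℝ) (u : U) (x : ℝ × ℝ) (hx : x ∈ Sec A ι U u) :
    c • x ∈ Sec A ι U (c • u) := by
  by_cases hc : c = 0
  · subst hc; rw [zero_smul, zero_smul, C.sec_zero]
  · have e : ((c • u : U) : Vec n) + ι (c • x) = c • ((u : Vec n) + ι x) := by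
      rw [map_smul, smul_add]; rfl
    rcases hx with h | h
    · left; rw [e, h, smul_zero]
    · right; rw [e, pm_smul hc]; exact h

lemma mk_cont : Continuous (fun v : {v : Vec n // v ≠ 0} => Projectivization.mk ℝ v.1 v.2) :=
  continuous_quotient_mk'

lemma Cor.bdd (C : Cor W A ι U) : ∃ δ : ℝ, 0 < δ ∧ ∀ v, pm A v → δ * ‖v‖ ≤ ‖C.pr v‖ := by
  have hcl : IsClosed {v : {v : Vec n // v ≠ 0} | Projectivization.mk ℝ v.1 v.2 ∈ A} :=
    C.cc.1.preimage mk_cont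
  obtain ⟨F, hF, hFe⟩ := isClosed_induced_iff.mp hcl
  have hmem : ∀ v : Vec n, v ≠ 0 → (v ∈ F ↔ pm A v) := by
    intro v hv
    have : (⟨v, hv⟩ : {v : Vec n // v ≠ 0}) ∈ Subtype.val ⁻¹' F ↔ Projectivization.mk ℝ v hv ∈ A := by
      rw [hFe]; rfl
    exact this.trans ⟨fun h => ⟨hv, h⟩, fun h => h.2⟩
  have hK : IsCompact (Metric.sphere (0 : Vec n) 1 ∩ F) := (isCompact_sphere _ _).inter_right hF
  have hs0 : ∀ v ∈ Metric.sphere (0 : Vec n) 1 ∩ F, 0 < ‖C.pr v‖ := by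
    rintro v ⟨h1, h2⟩
    have hv : v ≠ 0 := by
      rintro rfl; simp at h1
    rw [norm_pos_iff]
    intro h
    exact C.notW ((hmem v hv).mp h2) (C.pr_zero.mp h)
  have hcont : Continuous fun v => ‖C.pr v‖ := (C.pr.continuous_of_finiteDimensional).norm
  have key : ∃ δ : ℝ, 0 < δ ∧ ∀ v ∈ Metric.sphere (0 : Vec n) 1 ∩ F, δ ≤ ‖C.pr v‖ := by
    by_cases hne : (Metric.sphere (0 : Vec n) 1 ∩ F).Nonempty
    · obtain ⟨v, hv, hmin⟩ := hK.exists_isMinOn hne hcont.continuousOn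
      exact ⟨_, hs0 v hv, fun w hw => hmin hw⟩
    · exact ⟨1, one_pos, fun v hv => absurd ⟨v, hv⟩ hne⟩
  obtain ⟨δ, hδ, hm⟩ := key
  refine ⟨δ, hδ, fun v hv => ?_⟩
  have hn : 0 < ‖v‖ := norm_pos_iff.mpr hv.ne
  have := hm (‖v‖⁻¹ • v) ⟨by simp [norm_smul, hn.ne'],
    (hmem _ (smul_ne_zero (inv_ne_zero hn.ne') hv.ne)).mpr ((pm_smul (inv_ne_zero hn.ne')).mpr hv)⟩
  rw [map_smul, norm_smul, norm_inv, norm_norm, inv_mul_eq_div, le_div_iff₀ hn] at this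
  exact this

lemma Cor.cpt (C : Cor W A ι U) (u : U) : IsCompact (Sec A ι U u) := by
  by_cases hu : u = 0
  · subst hu; rw [C.zero_eq]; exact isCompact_singleton
  apply Metric.isCompact_of_isClosed_isBounded
  · have hc : Continuous (fun x : ℝ × ℝ => (⟨u + ι x, C.u0 hu x⟩ : {v : Vec n // v ≠ 0})) := by
      refine Continuous.subtype_mk ?_ _
      exact continuous_const.add ι.continuous_of_finiteDimensional
    have := C.cc.1.preimage (mk_cont.comp hc)
    refine (Set.ext fun x => ?_ : Sec A ι U u = _) ▸ this
    rw [C.sec_iff hu]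
    exact ⟨fun h => h.2, fun h => ⟨C.u0 hu x, h⟩⟩
  · obtain ⟨δ, hδ, hm⟩ := C.bdd
    obtain ⟨K, hK, hL⟩ := ι.exists_antilipschitzWith (LinearMap.ker_eq_bot.mpr C.inj)
    rw [isBounded_iff_forall_norm_le]
    refine ⟨K * (‖u‖ / δ + ‖u‖), fun x hx => ?_⟩
    have h1 := hm _ ((C.sec_iff hu x).mp hx)
    rw [map_add, C.pr_u, C.pr_ι, add_zero, mul_comm, ← le_div_iff₀ hδ] at h1
    have h2 : ‖ι x‖ ≤ ‖u‖ / δ + ‖u‖ := by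
      have : ι x = ((u : Vec n) + ι x) - u := by abel
      rw [this]
      exact (norm_sub_le _ _).trans (add_le_add h1 le_rfl)
    have h3 := hL.le_mul_dist x 0
    rw [map_zero, dist_zero_right, dist_zero_right] at h3
    exact h3.trans (mul_le_mul_of_nonneg_left h2 K.2)
end

section
variable {n : ℕ} {W : Submodule ℝ (Vec n)} {A : Set (Pt n)} {ι : ℝ × ℝ →ₗ[ℝ] Vec n}
    {U : Submodule ℝ (Vec n)}

lemma Cor.sep (C : Cor W A ι U) {u v : U} (hu : u ≠ 0) (hv : v ≠ 0) {z1 z2 d : ℝ × ℝ}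
    (f : ℝ × ℝ →ₗ[ℝ] ℝ) (hd : 0 < f d)
    (h1 : ∀ x ∈ Sec A ι U u, f x < f z1) (h2 : ∀ x ∈ Sec A ι U v, f x < f z2) :
    ¬ pm A ((u : Vec n) + v + ι (z1 + z2)) := by
  set T : Submodule ℝ (Vec n) := (LinearMap.ker f).map ι with hT
  have hTW : T ≤ W := by
    rintro _ ⟨x, -, rfl⟩; exact C.mem x
  have hfin : finrank ℝ T + 1 = finrank ℝ W := by
    have e1 : finrank ℝ T = finrank ℝ (LinearMap.ker f) :=
      (Submodule.equivMapOfInjective ι C.inj (LinearMap.ker f)).finrank_eq.symm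
    have e2 := f.finrank_range_add_finrank_ker
    have e3 : LinearMap.range f = ⊤ := by
      rw [LinearMap.range_eq_top]
      intro c
      exact ⟨(c / f d) • d, by rw [map_smul, smul_eq_mul, div_mul_cancel₀ _ hd.ne']⟩
    rw [e3] at e2
    simp at e2
    rw [e1, C.fr]; omega
  obtain ⟨ψ, p1, p2⟩ := (C.cc.2.2.2 T hTW hfin).2.pm
  have hTA : ∀ x, pm A x → x ∉ T := fun x hx h => C.notW hx (hTW h)
  have key : ∀ (w : U) (z : ℝ × ℝ), w ≠ 0 → (∀ x ∈ Sec A ι U w, f x < f z) →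
      pm (projImage T A)ᶜ (T.mkQ (w + ι z)) := by
    intro w z hw h
    rw [pm_projImage hTA (fun h => C.uW hw z (hTW h))]
    rintro _ ⟨k, hk, rfl⟩ hp
    rw [add_assoc, ← map_add, ← C.sec_iff hw] at hp
    have := h _ hp
    rw [map_add, LinearMap.mem_ker.mp hk, add_zero] at this
    exact lt_irrefl _ this
  have hdT : ι d ∉ T := by
    rintro ⟨k, hk, e⟩
    have := C.inj e
    subst this
    exact hd.ne' (LinearMap.mem_ker.mp hk)
  have k0 : pm (projImage T A)ᶜ (T.mkQ (ι d)) := by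
    rw [pm_projImage hTA hdT]
    intro w hw hp
    exact C.notW hp (W.add_mem (C.mem d) (hTW hw))
  have sgn : ∀ (w : U) (z : ℝ × ℝ), w ≠ 0 → (∀ x ∈ Sec A ι U w, f x < f z) →
      0 < ψ (T.mkQ (w + ι z)) * ψ (T.mkQ (ι d)) := by
    intro w z hw h
    have g0 := p1 _ k0
    rcases lt_or_gt_of_ne (mul_ne_zero (p1 _ (key w z hw h)) g0) with hlt | hgt
    · exfalso
      set t := - ψ (T.mkQ (w + ι z)) / ψ (T.mkQ (ι d)) with ht
      have htp : 0 < t := by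
        have : t = -(ψ (T.mkQ (w + ι z)) * ψ (T.mkQ (ι d))) / (ψ (T.mkQ (ι d)))^2 := by
          rw [ht]; field_simp
        rw [this]
        exact div_pos (by linarith) (by positivity)
      have := p1 _ (key w (z + t • d) hw (fun x hx => by
        have := h x hx
        rw [map_add, map_smul, smul_eq_mul]
        have := mul_pos htp hd
        linarith))
      apply this
      rw [map_add ι, map_smul ι, ← add_assoc, map_add T.mkQ, map_add ψ, map_smul T.mkQ, map_smul ψ,
        smul_eq_mul, ht, div_mul_cancel₀ _ g0, add_neg_cancel]
    · exact hgt
  have s1 := sgn u z1 hu h1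
  have s2 := sgn v z2 hv h2
  have hprod : 0 < ψ (T.mkQ (u + ι z1)) * ψ (T.mkQ (v + ι z2)) := by
    have := mul_pos s1 s2
    have g0 : 0 < ψ (T.mkQ (ι d)) ^ 2 := by have := p1 _ k0; positivity
    by_contra hh
    nlinarith
  have hfinal := p2 _ _ (key u z1 hu h1) (key v z2 hv h2) hprod
  intro hp
  rw [← map_add] at hfinal
  have e : (u : Vec n) + ι z1 + (v + ι z2) = (u : Vec n) + v + ι (z1 + z2) := by
    rw [map_add]; abel
  rw [e] at hfinal
  rw [pm_projImage hTA (fun h => C.notW hp (hTW h))] at hfinal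
  apply hfinal 0 T.zero_mem
  rwa [add_zero]

lemma Cor.add (C : Cor W A ι U) (u v : U) (z : ℝ × ℝ) (hz : z ∈ Sec A ι U (u + v)) :
    ∃ x ∈ Sec A ι U u, ∃ y ∈ Sec A ι U v, z = x + y := by
  by_cases hu : u = 0
  · subst hu
    exact ⟨0, (C.sec_zero 0).mpr rfl, z, by simpa using hz, by simp⟩
  by_cases hv : v = 0
  · subst hv
    exact ⟨z, by simpa using hz, 0, (C.sec_zero 0).mpr rfl, by simp⟩
  by_cases huv : u + v = 0
  · rw [huv, C.sec_zero] at hz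
    obtain ⟨x, hx⟩ := C.ne u
    refine ⟨x, hx, -x, ?_, by rw [hz]; simp⟩
    have := C.smul (-1) u x hx
    have e1 : (-1 : ℝ) • u = -u := by module
    rw [neg_one_smul, e1] at this
    rwa [eq_neg_of_add_eq_zero_right huv]
  by_contra hcon
  have hnot : z ∉ Sec A ι U u + Sec A ι U v := by
    rintro ⟨x, hx, y, hy, rfl⟩
    exact hcon ⟨x, hx, y, hy, rfl⟩
  obtain ⟨f, c, hf1, hf2⟩ := geometric_hahn_banach_closed_point ((C.conv u).add (C.conv v))
    ((C.cpt u).add (C.cpt v)).isClosed hnot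
  obtain ⟨x, hx, hxm⟩ := (C.cpt u).exists_isMaxOn (C.ne u) f.continuous.continuousOn
  obtain ⟨y, hy, hym⟩ := (C.cpt v).exists_isMaxOn (C.ne v) f.continuous.continuousOn
  have hlt : f (x + y) < f z := (hf1 _ (Set.add_mem_add hx hy)).trans hf2
  rw [map_add] at hlt
  have hd : 0 < f (z - x - y) := by rw [map_sub, map_sub]; linarith
  have := C.sep hu hv (z1 := x + (1/2 : ℝ) • (z - x - y)) (z2 := y + (1/2 : ℝ) • (z - x - y))
    (d := z - x - y) (f : ℝ × ℝ →ₗ[ℝ] ℝ) hd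
    (fun x' hx' => by
      have h1 : f x' ≤ f x := hxm hx'
      show f x' < f _
      rw [map_add, map_smul, smul_eq_mul]; linarith)
    (fun x' hx' => by
      have h1 : f x' ≤ f y := hym hx'
      show f x' < f _
      rw [map_add, map_smul, smul_eq_mul]; linarith)
  apply this
  have e : x + (1/2 : ℝ) • (z - x - y) + (y + (1/2 : ℝ) • (z - x - y)) = z := by module
  rw [e]
  have := (C.sec_iff huv z).mp hz
  simpa using this

lemma Cor.sys (C : Cor W A ι U) : Sys (Sec A ι U) := ⟨C.cpt, C.conv, C.ne, C.smul, C.add⟩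

lemma Cor.ptAt (C : Cor W A ι U) {I : Set (Pt n)} (hI : I ⊆ projSet W) {b b' : ℝ × ℝ}
    (hb : ∀ x y : ℝ, 0 < x → 0 < y → pm Iᶜ (ι (x • b + y • b')))
    (hp : ∀ N : Submodule ℝ (Vec n), W ≤ N → finrank ℝ N = 3 → PointedWrt W N I (A ∩ projSet N))
    (u : U) : PtAt (Sec A ι U) b b' u := by
  by_cases hu : u = 0
  · subst hu
    refine ⟨0, (C.sec_zero 0).mpr rfl, 0, (C.sec_zero 0).mpr rfl, ?_⟩
    intro x hx α _ β _
    rw [(C.sec_zero x).mp hx]; simp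
  obtain ⟨p', ⟨hpA, hpN⟩, q', ⟨hqA, hqN⟩, hP⟩ := hp (NN W U u) le_sup_left (C.NN_fr hu)
  obtain ⟨cp, p, hcp, ep, hps⟩ := C.ex_sec (pm_rep.mpr hpA) hpN
  obtain ⟨cq, q, hcq, eq, hqs⟩ := C.ex_sec (pm_rep.mpr hqA) hqN
  refine ⟨p, hps, q, hqs, ?_⟩
  intro x hx α hα β hβ
  set w := α • b + β • b' with hw
  have hwI : pm Iᶜ (ι w) := hb α β hα hβ
  have hw0 : ι w ≠ 0 := hwI.ne
  set P : Submodule ℝ (Vec n) := Submodule.span ℝ {(u : Vec n) + ι x, ι w} with hPdef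
  have hmemP : ∀ v, v ∈ P ↔ ∃ c d : ℝ, c • ((u : Vec n) + ι x) + d • ι w = v := fun v =>
    Submodule.mem_span_pair
  have hprP : ∀ c d : ℝ, C.pr (c • ((u : Vec n) + ι x) + d • ι w) = c • u := by
    intro c d
    rw [map_add, map_smul, map_smul, map_add, C.pr_u, C.pr_ι, C.pr_ι]; simp
  have hPN : P ≤ NN W U u := by
    intro v hv
    obtain ⟨c, d, rfl⟩ := (hmemP v).mp hv
    refine C.NN_mem.mpr ⟨c, c • x + d • w, ?_⟩
    rw [map_add ι (c • x), map_smul ι c, map_smul ι d, smul_add, add_assoc]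
  have hli : LinearIndependent ℝ ![(u : Vec n) + ι x, ι w] := by
    rw [LinearIndependent.pair_iff]
    intro c d h
    have h1 := hprP c d
    rw [h, map_zero] at h1
    have hc : c = 0 := (smul_eq_zero.mp h1.symm).resolve_right hu
    subst hc
    refine ⟨rfl, ?_⟩
    rw [zero_smul, zero_add] at h
    exact (smul_eq_zero.mp h).resolve_right hw0
  have hPf : finrank ℝ P = 2 := by
    have := finrank_span_eq_card hli
    rw [Matrix.range_cons, Matrix.range_cons, Matrix.range_empty, union_empty, singleton_union] at this
    exact this
  have hPI : ∀ y ∈ I, y.rep ∉ P := by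
    intro y hy hyP
    obtain ⟨c, d, e⟩ := (hmemP _).mp hyP
    have h1 := hprP c d
    have hyW : y.rep ∈ W := hI hy
    rw [e, C.pr_zero.mpr hyW] at h1
    have hc : c = 0 := (smul_eq_zero.mp h1.symm).resolve_right hu
    subst hc
    rw [zero_smul, zero_add] at e
    have hd : d ≠ 0 := by
      rintro rfl
      apply y.rep_nonzero
      rw [← e, zero_smul]
    have := pm_rep.mpr hy
    rw [← e, pm_smul hd] at this
    exact (pm_compl hw0).mp hwI this
  have hex : ∃ y ∈ A ∩ projSet (NN W U u), y.rep ∈ P := by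
    have hx' := (C.sec_iff hu x).mp hx
    have hmP : (u : Vec n) + ι x ∈ P := (hmemP _).mpr ⟨1, 0, by simp⟩
    exact ⟨_, ⟨hx'.2, (mk_mem_projSet hx'.1).mpr (hPN hmP)⟩, (mk_mem_projSet hx'.1).mpr hmP⟩
  have hmain := (hP P hPN (by rw [hPf, C.NN_fr hu]) hPI).mp hex
  obtain ⟨g, hg⟩ : ∃ g : Module.Dual ℝ U, g u = 1 := by
    obtain ⟨g, hg⟩ : ∃ g : Module.Dual ℝ U, g u ≠ 0 := by
      by_contra hh
      push Not at hh
      exact hu ((Module.forall_dual_apply_eq_zero_iff ℝ u).mp hh)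
    exact ⟨(g u)⁻¹ • g, by simp [hg]⟩
  have hφ : ∀ (c : ℝ) (y : ℝ × ℝ), (g ∘ₗ C.pr) (c • ((u : Vec n) + ι y)) = c := by
    intro c y
    simp [C.pr_u, C.pr_ι, hg]
  obtain ⟨t, ⟨ht0, ht1⟩, ht⟩ := hmain (g ∘ₗ C.pr)
    (fun v hv => by simp [C.pr_zero.mpr hv]) (by rw [ep, hφ]; exact hcp) (by rw [eq, hφ]; exact hcq)
  rw [ep, eq, hφ, hφ, smul_smul cp⁻¹, smul_smul cq⁻¹, inv_mul_cancel₀ hcp, inv_mul_cancel₀ hcq,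
    one_smul, one_smul] at ht
  obtain ⟨c, d, e⟩ := (hmemP _).mp ht
  have e1 : C.pr (t • ((u : Vec n) + ι p) + (1 - t) • ((u : Vec n) + ι q)) = u := by
    simp only [map_add, map_smul, C.pr_u, C.pr_ι]
    module
  rw [← e, hprP] at e1
  have hc : c = 1 := by
    have : (c - 1) • u = 0 := by
      have e5 : (c - 1) • u = c • u - u := by module
      rw [e5, e1, sub_self]
    have := (smul_eq_zero.mp this).resolve_right hu
    linarith
  subst hc
  have e2 : ι (x + d • w) = ι (t • p + (1 - t) • q) := by
    have h3 : ι (x + d • w) - ι (t • p + (1 - t) • q) =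
        ((1 : ℝ) • ((u : Vec n) + ι x) + d • ι w) -
          (t • ((u : Vec n) + ι p) + (1 - t) • ((u : Vec n) + ι q)) := by
      simp only [map_add, map_smul]; module
    rw [e, sub_self] at h3
    exact sub_eq_zero.mp h3
  have e3 := congrArg (dt w) (C.inj e2)
  clear_value w
  rw [dt_add_right, dt_smul_right, dt_add_right, dt_smul_right, dt_smul_right] at e3
  have e4 : dt w w = 0 := by simp only [dt]; ring
  rw [e4, mul_zero, add_zero] at e3
  rw [e3]
  constructor
  · have h1 := min_le_left (dt w p) (dt w q)
    have h2 := min_le_right (dt w p) (dt w q)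
    nlinarith
  · have h1 := le_max_left (dt w p) (dt w q)
    have h2 := le_max_right (dt w p) (dt w q)
    nlinarith
end

section
variable {n : ℕ} {W : Submodule ℝ (Vec n)}

lemma half {I : Set (Pt n)} {e e' : Pt n} (he : e ∈ projSet W) (he' : e' ∈ projSet W)
    (hee : e ≠ e')
    (hfr : frontier {z : ↥(projSet W) | (z : Pt n) ∈ I} =
      {z : ↥(projSet W) | (z : Pt n) = e ∨ (z : Pt n) = e'}) {ε : ℝ} (hε : ε ≠ 0) :
    (∀ x y : ℝ, 0 < x → 0 < y → pm I (x • e.rep + (ε * y) • e'.rep)) ∨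
    (∀ x y : ℝ, 0 < x → 0 < y → pm Iᶜ (x • e.rep + (ε * y) • e'.rep)) := by
  have hli : ∀ x y : ℝ, x • e.rep + y • e'.rep = 0 → x = 0 ∧ y = 0 := by
    have h1 : LinearIndependent ℝ ![e.rep, e'.rep] := by
      rw [LinearIndependent.pair_iff]
      intro x y h
      have key : ∀ (a b : Pt n) (x y : ℝ), a ≠ b → x • a.rep + y • b.rep = 0 → x = 0 := by
        intro a b x y hab h
        by_contra hx
        apply hab
        rw [← a.mk_rep, ← b.mk_rep, Projectivization.mk_eq_mk_iff']
        refine ⟨-(x⁻¹ * y), ?_⟩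
        have h2 : x • a.rep = (-y) • b.rep := by
          rw [neg_smul]; exact eq_neg_of_add_eq_zero_left h
        have h3 : a.rep = x⁻¹ • (x • a.rep) := by rw [smul_smul, inv_mul_cancel₀ hx, one_smul]
        rw [h3, h2, smul_smul]; congr 1; ring
      exact ⟨key e e' x y hee h, key e' e y x hee.symm (by rw [add_comm]; exact h)⟩
    exact LinearIndependent.pair_iff.mp h1
  let Q : Set (ℝ × ℝ) := Ioi 0 ×ˢ Ioi 0
  have hQ : IsPreconnected Q := ((convex_Ioi 0).prod (convex_Ioi 0)).isPreconnected
  haveI : PreconnectedSpace Q := isPreconnected_iff_preconnectedSpace.mp hQ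
  let g0 : Q → Vec n := fun z => z.1.1 • e.rep + (ε * z.1.2) • e'.rep
  have g0ne : ∀ z, g0 z ≠ 0 := fun z h => z.2.1.ne' (hli _ _ h).1
  have g0W : ∀ z, g0 z ∈ W := fun z => W.add_mem (W.smul_mem _ he) (W.smul_mem _ he')
  have g0c : Continuous g0 := by
    apply Continuous.add
    · exact (continuous_fst.comp continuous_subtype_val).smul continuous_const
    · exact (continuous_const.mul (continuous_snd.comp continuous_subtype_val)).smul continuous_const
  let g : Q → ↥(projSet W) := fun z => ⟨Projectivization.mk ℝ (g0 z) (g0ne z),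
    (mk_mem_projSet (g0ne z)).mpr (g0W z)⟩
  have gc : Continuous g := by
    refine Continuous.subtype_mk ?_ _
    exact mk_cont.comp (g0c.subtype_mk g0ne)
  have hcl : IsClopen (g ⁻¹' {z : ↥(projSet W) | (z : Pt n) ∈ I}) := by
    rw [isClopen_iff_frontier_eq_empty, eq_empty_iff_forall_notMem]
    intro z hz
    have := gc.frontier_preimage_subset _ hz
    rw [hfr] at this
    have hz1 : 0 < z.1.1 := z.2.1
    have hz2 : 0 < z.1.2 := z.2.2
    rcases this with h | h
    · rw [← e.mk_rep] at h
      obtain ⟨c, hc⟩ := (Projectivization.mk_eq_mk_iff' ℝ _ _ _ _).mp h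
      have := hli (z.1.1 - c) (ε * z.1.2) (by
        have : (z.1.1 - c) • e.rep + (ε * z.1.2) • e'.rep = g0 z - c • e.rep := by
          simp only [g0]; module
        rw [this, hc, sub_self])
      exact mul_ne_zero hε hz2.ne' this.2
    · rw [← e'.mk_rep] at h
      obtain ⟨c, hc⟩ := (Projectivization.mk_eq_mk_iff' ℝ _ _ _ _).mp h
      have := hli (z.1.1) (ε * z.1.2 - c) (by
        have : (z.1.1) • e.rep + (ε * z.1.2 - c) • e'.rep = g0 z - c • e'.rep := by
          simp only [g0]; module
        rw [this, hc, sub_self])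
      exact hz1.ne' this.1
  rcases isClopen_iff.mp hcl with h | h
  · right
    intro x y hx hy
    have hm : (⟨(x, y), hx, hy⟩ : Q) ∉ g ⁻¹' {z : ↥(projSet W) | (z : Pt n) ∈ I} := by
      rw [h]; exact notMem_empty _
    exact ⟨g0ne ⟨(x, y), hx, hy⟩, hm⟩
  · left
    intro x y hx hy
    have hm : (⟨(x, y), hx, hy⟩ : Q) ∈ g ⁻¹' {z : ↥(projSet W) | (z : Pt n) ∈ I} := by
      rw [h]; exact mem_univ _
    exact ⟨g0ne ⟨(x, y), hx, hy⟩, hm⟩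

lemma two_reps (hW : finrank ℝ W = 2) {e e' : Pt n} (he : e ∈ projSet W) (he' : e' ∈ projSet W)
    (hee : e ≠ e') : LinearIndependent ℝ ![e.rep, e'.rep] ∧
      Submodule.span ℝ {e.rep, e'.rep} = W := by
  have h1 : LinearIndependent ℝ ![e.rep, e'.rep] := by
    rw [LinearIndependent.pair_iff]
    intro x y h
    have key : ∀ (a b : Pt n) (x y : ℝ), a ≠ b → x • a.rep + y • b.rep = 0 → x = 0 := by
      intro a b x y hab h
      by_contra hx
      apply hab
      rw [← a.mk_rep, ← b.mk_rep, Projectivization.mk_eq_mk_iff']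
      refine ⟨-(x⁻¹ * y), ?_⟩
      have h2 : x • a.rep = (-y) • b.rep := by
        rw [neg_smul]; exact eq_neg_of_add_eq_zero_left h
      have h3 : a.rep = x⁻¹ • (x • a.rep) := by rw [smul_smul, inv_mul_cancel₀ hx, one_smul]
      rw [h3, h2, smul_smul]; congr 1; ring
    exact ⟨key e e' x y hee h, key e' e y x hee.symm (by rw [add_comm]; exact h)⟩
  refine ⟨h1, ?_⟩
  apply Submodule.eq_of_le_of_finrank_eq
  · rw [Submodule.span_le]
    rintro v (rfl | rfl)
    · exact he
    · exact he'
  · have := finrank_span_eq_card h1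
    rw [Matrix.range_cons, Matrix.range_cons, Matrix.range_empty, union_empty, singleton_union] at this
    rw [this, hW]; rfl

lemma altV (hW : finrank ℝ W = 2) {I : Set (Pt n)} {e e' : Pt n} (he : e ∈ projSet W)
    (he' : e' ∈ projSet W) (hee : e ≠ e') (hI : e ∈ I ∧ e' ∈ I)
    (hc : (projSet W \ I).Nonempty)
    (hfr : frontier {z : ↥(projSet W) | (z : Pt n) ∈ I} =
      {z : ↥(projSet W) | (z : Pt n) = e ∨ (z : Pt n) = e'}) :
    (∀ x y : ℝ, 0 < x → 0 < y → pm Iᶜ (x • e.rep + y • e'.rep)) ∨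
    (∀ x y : ℝ, 0 < x → 0 < y → pm Iᶜ (x • e.rep - y • e'.rep)) := by
  have hp := half he he' hee hfr (ε := 1) one_ne_zero
  have hm := half he he' hee hfr (ε := -1) (by norm_num)
  simp only [one_mul] at hp
  simp only [neg_one_mul, neg_smul, ← sub_eq_add_neg] at hm
  rcases hp with hp | hp
  swap
  · exact Or.inl hp
  rcases hm with hm | hm
  swap
  · exact Or.inr hm
  exfalso
  obtain ⟨z, hzW, hzI⟩ := hc
  have hz : z.rep ∈ W := hzW
  rw [← (two_reps hW he he' hee).2, Submodule.mem_span_pair] at hz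
  obtain ⟨x, y, hxy⟩ := hz
  apply hzI
  rw [← pm_rep, ← hxy]
  have hz0 : x • e.rep + y • e'.rep ≠ 0 := by rw [hxy]; exact z.rep_nonzero
  rcases lt_trichotomy x 0 with hx | hx | hx <;> rcases lt_trichotomy y 0 with hy | hy | hy
  · rw [← pm_neg]
    convert hp (-x) (-y) (by linarith) (by linarith) using 1; module
  · subst hy
    rw [zero_smul, add_zero, pm_smul hx.ne]; exact pm_rep.mpr hI.1
  · rw [← pm_neg]
    convert hm (-x) (y) (by linarith) (by linarith) using 1; module
  · subst hx
    rw [zero_smul, zero_add, pm_smul hy.ne]; exact pm_rep.mpr hI.2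
  · subst hx; subst hy; simp at hz0
  · subst hx
    rw [zero_smul, zero_add, pm_smul hy.ne']; exact pm_rep.mpr hI.2
  · convert hm x (-y) (by linarith) (by linarith) using 1; module
  · subst hy
    rw [zero_smul, add_zero, pm_smul hx.ne']; exact pm_rep.mpr hI.1
  · exact hp x y hx hy
end

/-- Let `A ⊆ ℝPⁿ` be `L`-convex-concave with `L = ℙ(W)` a projective
line, let `a 0, …, a 3` be four distinct points of `L` dividing `L` into four pairwise
disjoint open arcs (the complements of the closed segments `I 0, …, I 3`, where `I i`
has endpoints `a i` and `a (i+1)`, the segments covering `L` and having pairwise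
disjoint complements).  If every planar section `A ∩ N` (for a 2-dimensional
projective subspace `N ⊇ L`) is pointed with respect to each `I i`, then `A` contains
a projective subspace of dimension `n − 2`. -/
theorem statement14 (n : ℕ) (W : Submodule ℝ (Vec n)) (hW : finrank ℝ W = 2)
    (A : Set (Pt n)) (hA : IsLConvexConcave W A)
    (a : Fin 4 → Pt n) (haL : ∀ i, a i ∈ projSet W) (hainj : Function.Injective a)
    (I : Fin 4 → Set (Pt n))
    (hIsub : ∀ i, I i ⊆ projSet W)
    (hIcl : ∀ i, IsClosed (I i))
    (hIconv : ∀ i, IsProjConvex (I i))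
    (hIends : ∀ i, a i ∈ I i ∧ a (i + 1) ∈ I i)
    (hIfr : ∀ i, frontier {z : ↥(projSet W) | (z : Pt n) ∈ I i} =
      {z : ↥(projSet W) | (z : Pt n) = a i ∨ (z : Pt n) = a (i + 1)})
    (hcompl : ∀ i, (projSet W \ I i).Nonempty)
    (hcover : ⋃ i, I i = projSet W)
    (hdisj : ∀ i j, i ≠ j → Disjoint (projSet W \ I i) (projSet W \ I j))
    (hpointed : ∀ N : Submodule ℝ (Vec n), W ≤ N → finrank ℝ N = 3 →
      ∀ i, PointedWrt W N (I i) (A ∩ projSet N)) :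
    ∃ M : Submodule ℝ (Vec n), finrank ℝ M = n - 1 ∧ projSet M ⊆ A := by
  have hne : ∀ i j, i ≠ j → a i ≠ a j := fun i j h h' => h (hainj h')
  have halt := fun i : Fin 4 => altV hW (haL i) (haL (i + 1)) (hne i (i + 1) (by
    fin_cases i <;> decide)) (hIends i) (hcompl i) (hIfr i)
  obtain ⟨ε, hε, hε0⟩ : ∃ ε : ℝ, ε * ε = 1 ∧ ∀ x y : ℝ, 0 < x → 0 < y →
      pm (I 0)ᶜ (x • (a 0).rep + y • (ε • (a 1).rep)) := by
    rcases halt 0 with h | h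
    · exact ⟨1, by norm_num, fun x y hx hy => by simpa using h x y hx hy⟩
    · exact ⟨-1, by norm_num, fun x y hx hy => by simpa [sub_eq_add_neg] using h x y hx hy⟩
  have hεn : ε ≠ 0 := by rintro rfl; norm_num at hε
  obtain ⟨hli, hspan⟩ := two_reps hW (haL 0) (haL 1) (hne 0 1 (by decide))
  rw [LinearIndependent.pair_iff] at hli
  let ι : ℝ × ℝ →ₗ[ℝ] Vec n := (LinearMap.fst ℝ ℝ ℝ).smulRight (a 0).rep +
    (LinearMap.snd ℝ ℝ ℝ).smulRight (ε • (a 1).rep)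
  have hι : ∀ x y : ℝ, ι (x, y) = x • (a 0).rep + y • (ε • (a 1).rep) := fun x y => rfl
  obtain ⟨U, hU⟩ := Submodule.exists_isCompl W
  have hinj : Function.Injective ι := by
    rw [injective_iff_map_eq_zero]
    rintro ⟨x, y⟩ h
    rw [hι, smul_smul] at h
    obtain ⟨h1, h2⟩ := hli _ _ h
    rw [h1, (mul_eq_zero.mp h2).resolve_right hεn]; rfl
  have hsurj : ∀ w ∈ W, ∃ x, ι x = w := by
    intro w hw
    rw [← hspan, Submodule.mem_span_pair] at hw
    obtain ⟨x, y, rfl⟩ := hw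
    refine ⟨(x, y * ε), ?_⟩
    rw [hι, smul_smul, mul_assoc, hε, mul_one]
  have hrng : LinearMap.range ι = W := by
    apply le_antisymm
    · rintro _ ⟨⟨x, y⟩, rfl⟩
      rw [hι]
      exact W.add_mem (W.smul_mem _ (haL 0)) (W.smul_mem _ (W.smul_mem _ (haL 1)))
    · intro w hw
      exact hsurj w hw
  have C : Cor W A ι U := ⟨hinj, hrng, hU.symm, hW, hA⟩
  choose β hβ using fun i : Fin 4 => hsurj (a i).rep (haL i)
  have hprop : ∀ i j, i ≠ j → ∀ c : ℝ, β i ≠ c • β j := by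
    intro i j hij c h
    apply hne i j hij
    rw [← (a i).mk_rep, ← (a j).mk_rep, Projectivization.mk_eq_mk_iff']
    refine ⟨c, ?_⟩
    rw [← hβ i, ← hβ j, h, map_smul]
  let J : Fin 4 → Set (ℝ × ℝ) := fun i => {w | pm (I i)ᶜ (ι w)}
  have hJneg : ∀ i, ∀ x ∈ J i, -x ∈ J i := by
    intro i x hx
    show pm _ _
    rw [map_neg, pm_neg]; exact hx
  have hJd : ∀ i j, i ≠ j → Disjoint (J i) (J j) := by
    intro i j hij
    rw [disjoint_left]
    rintro w ⟨h0, h1⟩ ⟨_, h2⟩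
    have hm : Projectivization.mk ℝ (ι w) h0 ∈ projSet W := (mk_mem_projSet h0).mpr (C.mem w)
    exact disjoint_left.mp (hdisj i j hij) ⟨hm, h1⟩ ⟨hm, h2⟩
  have hJalt : ∀ i, Alt (J i) (β i) (β (i + 1)) := by
    intro i
    rcases halt i with h | h
    · left; intro x y hx hy
      show pm _ _
      rw [map_add, map_smul, map_smul, hβ, hβ]; exact h x y hx hy
    · right; intro x y hx hy
      show pm _ _
      rw [map_sub, map_smul, map_smul, hβ, hβ]; exact h x y hx hy
  have b0 : β 0 = (1, 0) := hinj (by rw [hβ, hι]; simp)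
  have b1 : β 1 = ε • (0, 1) := hinj (by rw [hβ, map_smul, hι, zero_smul, zero_add, one_smul,
    smul_smul, hε, one_smul])
  have hform : ∀ i : Fin 4, i ≠ 0 → i ≠ 1 → ∃ c q : ℝ, c ≠ 0 ∧ q ≠ 0 ∧ β i = c • ((-1 : ℝ), q) := by
    intro i h0 h1
    rcases hb : β i with ⟨p, r⟩
    have hp : p ≠ 0 := by
      rintro rfl
      apply hprop i 1 h1 (r * ε)
      rw [b1, smul_smul, mul_assoc, hε, mul_one, hb]; simp
    have hr : r ≠ 0 := by
      rintro rfl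
      apply hprop i 0 h0 p
      rw [b0, hb]; simp
    refine ⟨-p, -r / p, by simpa using hp, div_ne_zero (by simpa using hr) hp, ?_⟩
    ext
    · simp
    · simp; field_simp
  obtain ⟨c2, q, hc2, hq, b2⟩ := hform 2 (by decide) (by decide)
  obtain ⟨c3, s, hc3, hs, b3⟩ := hform 3 (by decide) (by decide)
  have hsq : s ≠ q := by
    rintro rfl
    apply hprop 2 3 (by decide) (c2 / c3)
    rw [b2, b3, smul_smul, div_mul_cancel₀ _ hc3]
  have A1 : Alt (J 1) (0, 1) (-1, q) := by
    have h : Alt (J 1) (β 1) (β 2) := hJalt 1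
    rw [b1, b2] at h
    exact ((h.right hc2).symm (hJneg 1)).right hεn |>.symm (hJneg 1)
  have A2 : Alt (J 2) (-1, q) (-1, s) := by
    have h : Alt (J 2) (β 2) (β 3) := hJalt 2
    rw [b2, b3] at h
    exact ((h.right hc3).symm (hJneg 2)).right hc2 |>.symm (hJneg 2)
  have A3 : Alt (J 3) (-1, s) (1, 0) := by
    have h : Alt (J 3) (β 3) (β 0) := hJalt 3
    rw [b3, b0] at h
    exact (h.symm (hJneg 3)).right hc3 |>.symm (hJneg 3)
  obtain ⟨hs0, hsq', r1, r2, r3⟩ := arcs hq hs hsq (hJneg 0) (hJd 0 1 (by decide))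
    (hJd 0 3 (by decide)) (hJd 1 2 (by decide)) (hJd 1 3 (by decide))
    (fun x y hx hy => hε0 x y hx hy) A1 A2 A3
  have hP := fun (i : Fin 4) N hN hN' => hpointed N hN hN' i
  obtain ⟨f, hf⟩ := C.sys.main hs0 hsq'
    (C.ptAt (hIsub 0) (b := (1, 0)) (b' := (0, 1)) (fun x y hx hy => by
      have e : x • ((1 : ℝ), (0 : ℝ)) + y • ((0 : ℝ), (1 : ℝ)) = (x, y) := by simp
      rw [e]; exact hε0 x y hx hy) (hP 0))
    (C.ptAt (hIsub 1) r1 (hP 1)) (C.ptAt (hIsub 2) r2 (hP 2)) (C.ptAt (hIsub 3) r3 (hP 3))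
  let F : U →ₗ[ℝ] Vec n := U.subtype + ι ∘ₗ f
  have hF : ∀ u : U, F u = (u : Vec n) + ι (f u) := fun u => rfl
  have hFinj : Function.Injective F := by
    intro u v h
    have := congrArg C.pr h
    rw [hF, hF, map_add, map_add, C.pr_u, C.pr_u, C.pr_ι, C.pr_ι, add_zero, add_zero] at this
    exact this
  refine ⟨LinearMap.range F, ?_, ?_⟩
  · rw [LinearMap.finrank_range_of_inj hFinj]
    have := Submodule.finrank_add_eq_of_isCompl hU
    rw [hW] at this
    simp at this
    omega
  · rintro x ⟨u, hu⟩
    rw [← pm_rep, ← hu, hF]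
    have h0 : (u : Vec n) + ι (f u) ≠ 0 := by
      rw [← hF, hu]; exact x.rep_nonzero
    exact (hf u).resolve_left h0

end CC
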